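/- arXiv:2402.05724 — 2 statements merged into one kernel-verified Lean document; each statement's English description precedes it below -/
import Mathlib

section
/- Let M̈ be a policy-aware model (PAM) on finite state space S and finite action space A with horizon H. If for every h ∈ {1,…,H}, s' ∈ S, s ∈ S, a ∈ A, the maps π ↦ P̈_h(s'|s,a,π) and π ↦ r̈_h(s,a,π) are continuous on the metric space (Π, d_{∞,1}), then M̈ has at least one Nash equilibrium: there exists π* ∈ Π such that J̈_{M̈}(π̃;π*) ≤ J̈_{M̈}(π*;π*) for all π̃ ∈ Π. -/
/-- ℓ1 distance between two functions on a finite type. -/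
def l1 {X : Type*} [Fintype X] (p q : X → ℝ) : ℝ := ∑ x, |p x - q x|

/-- A (nonstationary Markov) policy: at each step `h` (0-indexed) and state `s`,
`π h s` is a probability distribution over actions. -/
def IsPolicy {S A : Type*} [Fintype A] (π : ℕ → S → A → ℝ) : Prop :=
  ∀ h s, (∀ a, 0 ≤ π h s a) ∧ ∑ a, π h s a = 1

/-- State law of executing `π̃` in a policy-aware model whose kernels are frozen by the
reference policy `π`. -/
def densPam {S A : Type*} [Fintype S] [Fintype A]
    (Pd : ℕ → S → A → (ℕ → S → A → ℝ) → S → ℝ)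
    (μ₁ : S → ℝ) (π πt : ℕ → S → A → ℝ) : ℕ → S → ℝ
  | 0 => μ₁
  | h + 1 => fun s' => ∑ s, ∑ a, densPam Pd μ₁ π πt h s * πt h s a * Pd h s a π s'

/-- The return `J̈_{M̈}(π̃;π)` of executing `π̃` in the PAM `M̈` with transitions and rewards
frozen by the reference policy `π`. -/
def Jpam {S A : Type*} [Fintype S] [Fintype A] (H : ℕ)
    (Pd : ℕ → S → A → (ℕ → S → A → ℝ) → S → ℝ)
    (rd : ℕ → S → A → (ℕ → S → A → ℝ) → ℝ)
    (μ₁ : S → ℝ) (πt π : ℕ → S → A → ℝ) : ℝ :=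
  ∑ h ∈ Finset.range H, ∑ s, ∑ a, densPam Pd μ₁ π πt h s * πt h s a * rd h s a π

/-- In a set with as many points as colours that misses some colour, an even number of facets
carries exactly the colours other than `i₀`. -/
theorem even_card_facets {I V : Type*} [Fintype I] [DecidableEq I] [DecidableEq V]
    (c : V → I) (i₀ : I) {P : Finset V} (hP : P.card = Fintype.card I)
    (hc : P.image c ≠ Finset.univ) {𝒟 : Finset (Finset V)}
    (h𝒟 : ∀ Q, Q ∈ 𝒟 ↔
      Q ⊆ P ∧ Q.card + 1 = Fintype.card I ∧ Q.image c = Finset.univ.erase i₀) :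
    Even 𝒟.card := by
  rcases 𝒟.eq_empty_or_nonempty with rfl | ⟨Q, hQ⟩
  · simp
  have hinj : ∀ Q ∈ 𝒟, Set.InjOn c Q := by
    intro Q hQ
    obtain ⟨-, h1, h2⟩ := (h𝒟 Q).1 hQ
    refine Finset.card_image_iff.1 ?_
    rw [h2, Finset.card_erase_of_mem (Finset.mem_univ _), Finset.card_univ]
    omega
  have herase : ∀ Q ∈ 𝒟, ∃ x ∉ Q, insert x Q = P := by
    intro Q hQ
    obtain ⟨h0, h1, -⟩ := (h𝒟 Q).1 hQ
    exact Finset.exists_eq_insert_iff.2 ⟨h0, by omega⟩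
  obtain ⟨x, hx, rfl⟩ := herase Q hQ
  obtain ⟨hsub, hcard, himg⟩ := (h𝒟 Q).1 hQ
  have hcx : c x ∈ Q.image c := by
    rw [himg]
    refine Finset.mem_erase.2 ⟨fun h => hc ?_, Finset.mem_univ _⟩
    rw [Finset.image_insert, himg, h, Finset.insert_erase (Finset.mem_univ _)]
  obtain ⟨q, hq, hqx⟩ := Finset.mem_image.1 hcx
  have hxq : x ≠ q := fun h => hx (h ▸ hq)
  have hset : 𝒟 = {Q, (insert x Q).erase q} := by
    ext R
    simp only [Finset.mem_insert, Finset.mem_singleton]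
    constructor
    · intro hR
      obtain ⟨z, hz, hzR⟩ := herase R hR
      have hRz : R = (insert x Q).erase z := by rw [← hzR, Finset.erase_insert hz]
      by_cases hzx : z = x
      · left; rw [hRz, hzx, Finset.erase_insert hx]
      by_cases hzq : z = q
      · right; rw [hRz, hzq]
      · refine absurd (hinj R hR ?_ ?_ hqx.symm) hxq
        · simp [hRz, Ne.symm hzx]
        · simp [hRz, Ne.symm hzq, hq]
    · rintro (rfl | rfl)
      · exact hQ
      · refine (h𝒟 _).2 ⟨Finset.erase_subset _ _, ?_, ?_⟩
        · rw [Finset.card_erase_of_mem (Finset.mem_insert_of_mem hq), hP]; omega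
        · rw [← himg]
          ext i
          simp only [Finset.mem_image, Finset.mem_erase, Finset.mem_insert]
          constructor
          · rintro ⟨a, ⟨-, rfl | ha⟩, rfl⟩
            · exact ⟨q, hq, hqx⟩
            · exact ⟨a, ha, rfl⟩
          · rintro ⟨a, ha, rfl⟩
            by_cases h : a = q
            · exact ⟨x, ⟨hxq, Or.inl rfl⟩, by rw [h, hqx]⟩
            · exact ⟨a, ⟨h, Or.inr ha⟩, rfl⟩
  rw [hset, Finset.card_pair]
  · exact even_two
  · intro h
    rw [h] at hq
    simp at hq

section Scarf

variable {I V α : Type*} [LinearOrder α]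

/-- `P` is dominated by the family of orders induced by `u`: every point lies weakly below all of
`P` in at least one of the orders. -/
def Dominated (u : I → V → α) (P : Finset V) : Prop :=
  ∀ y, ∃ i, ∀ x ∈ P, u i y ≤ u i x

theorem Dominated.mono {u : I → V → α} {P Q : Finset V} (hP : Dominated u P) (h : Q ⊆ P) :
    Dominated u Q := fun y =>
  let ⟨i, hi⟩ := hP y
  ⟨i, fun x hx => hi x (h hx)⟩

theorem Dominated.exists_injOn {u : I → V → α} (hu : ∀ i, Function.Injective (u i))
    {P : Finset V} (hP : Dominated u P) :
    ∃ L : V → I, (∀ q ∈ P, ∀ x ∈ P, u (L q) q ≤ u (L q) x) ∧ Set.InjOn L P := by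
  choose L hL using hP
  refine ⟨L, fun q _ => hL q, fun q hq q' hq' h => hu (L q) (le_antisymm (hL q q' hq') ?_)⟩
  have := hL q' q hq
  rwa [← h] at this

variable [Fintype I] [DecidableEq I] [Fintype V] [DecidableEq V]

/-- **Scarf's pivoting lemma**: a dominated set of cardinality one less than the number of orders
has exactly two dominated one-point extensions, provided that both pivots are possible. -/
theorem Dominated.exists_pivots {u : I → V → α} (hu : ∀ i, Function.Injective (u i))
    {Q : Finset V} (hQ : Dominated u Q) (hcard : Q.card + 1 = Fintype.card I) (hne : Q.Nonempty)
    (hM : ∀ k, ∃ y, ∀ l, l ≠ k → ∃ q ∈ Q, u l q < u l y) :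
    ∃ x₁ x₂, x₁ ≠ x₂ ∧ ∀ x, (x ∉ Q ∧ Dominated u (insert x Q)) ↔ (x = x₁ ∨ x = x₂) := by
  obtain ⟨L, hL, hLinj⟩ := hQ.exists_injOn hu
  obtain ⟨j, hj⟩ : ∃ j, j ∉ Q.image L := by
    by_contra! h
    have := Finset.card_image_of_injOn hLinj
    rw [Finset.eq_univ_iff_forall.2 h, Finset.card_univ] at this
    omega
  obtain ⟨q₀, hq₀, hmin⟩ := Q.exists_min_image (u j) hne
  have hmax : ∀ k, ∃ x, (∀ l, l ≠ k → ∃ q ∈ Q, u l q < u l x) ∧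
      ∀ y, (∀ l, l ≠ k → ∃ q ∈ Q, u l q < u l y) → u k y ≤ u k x := by
    intro k
    classical
    obtain ⟨x, hx, hx'⟩ := (Finset.univ.filter
      fun y => ∀ l, l ≠ k → ∃ q ∈ Q, u l q < u l y).exists_max_image (u k)
      (by obtain ⟨y, hy⟩ := hM k; exact ⟨y, by simpa using hy⟩)
    exact ⟨x, by simpa using hx, fun y hy => hx' y (by simpa using hy)⟩
  have hlow : ∀ k y, (∀ l, l ≠ k → ∃ q ∈ Q, u l q < u l y) → ∀ q ∈ Q, u k y ≤ u k q := by
    intro k y hy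
    obtain ⟨l, hl⟩ := hQ y
    by_cases h : l = k
    · exact h ▸ hl
    · obtain ⟨q, hq, hlt⟩ := hy l h
      exact absurd (hl q hq) (not_le.2 hlt)
  have hij : L q₀ ≠ j := fun h => hj (h ▸ Finset.mem_image_of_mem L hq₀)
  have hback : ∀ k x, (∀ q ∈ Q, ∃ l, l ≠ k ∧ ∀ p ∈ Q, u l q ≤ u l p) →
      (∀ l, l ≠ k → ∃ q ∈ Q, u l q < u l x) →
      (∀ y, (∀ l, l ≠ k → ∃ q ∈ Q, u l q < u l y) → u k y ≤ u k x) →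
      x ∉ Q ∧ Dominated u (insert x Q) := by
    intro k x hcov hx hxm
    refine ⟨fun hxQ => ?_, fun y => ?_⟩
    · obtain ⟨l, hl, hl'⟩ := hcov x hxQ
      obtain ⟨q, hq, hlt⟩ := hx l hl
      exact absurd (hl' q hq) (not_le.2 hlt)
    · by_cases hy : ∀ l, l ≠ k → ∃ q ∈ Q, u l q < u l y
      · refine ⟨k, fun p hp => ?_⟩
        rcases Finset.mem_insert.1 hp with rfl | hp
        · exact hxm y hy
        · exact hlow k y hy p hp
      · push Not at hy
        obtain ⟨l, hl, hly⟩ := hy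
        refine ⟨l, fun p hp => ?_⟩
        rcases Finset.mem_insert.1 hp with rfl | hp
        · obtain ⟨q, hq, hlt⟩ := hx l hl
          exact (hly q hq).trans hlt.le
        · exact hly p hp
  obtain ⟨x₁, hx₁, hm₁⟩ := hmax (L q₀)
  obtain ⟨x₂, hx₂, hm₂⟩ := hmax j
  refine ⟨x₁, x₂, ?_, fun x => ⟨fun ⟨hxQ, hdom⟩ => ?_, ?_⟩⟩
  · rintro rfl
    obtain ⟨q, hq, hlt⟩ := hx₁ j hij.symm
    exact absurd (hlow j x₁ hx₂ q hq) (not_le.2 hlt)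
  · obtain ⟨L', hL', hinj'⟩ := hdom.exists_injOn hu
    have hsurj : ∀ l, ∃ p ∈ insert x Q, L' p = l := by
      have hc := Finset.card_image_of_injOn hinj'
      rw [Finset.card_insert_of_notMem hxQ, hcard] at hc
      intro l
      exact Finset.mem_image.1 (Finset.eq_univ_of_card _ hc ▸ Finset.mem_univ l)
    have hold : ∀ l, l ≠ L' x → ∃ p ∈ Q, ∀ z ∈ insert x Q, u l p ≤ u l z := by
      intro l hl
      obtain ⟨p, hp, rfl⟩ := hsurj l
      refine ⟨p, (Finset.mem_insert.1 hp).resolve_left (fun h => hl (h ▸ rfl)), hL' p hp⟩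
    have hxM : ∀ l, l ≠ L' x → ∃ q ∈ Q, u l q < u l x := by
      intro l hl
      obtain ⟨p, hp, hpm⟩ := hold l hl
      exact ⟨p, hp, (hpm x (Finset.mem_insert_self _ _)).lt_of_ne
        fun h => hxQ (hu l h ▸ hp)⟩
    have hxmax : ∀ y, (∀ l, l ≠ L' x → ∃ q ∈ Q, u l q < u l y) → u (L' x) y ≤ u (L' x) x := by
      intro y hy
      obtain ⟨l, hl⟩ := hdom y
      by_cases h : l = L' x
      · exact h ▸ hl x (Finset.mem_insert_self _ _)
      · obtain ⟨q, hq, hlt⟩ := hy l h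
        exact absurd (hl q (Finset.mem_insert_of_mem hq)) (not_le.2 hlt)
    have hk : L' x = L q₀ ∨ L' x = j := by
      by_contra! h
      have key : ∀ l, l ≠ L' x → (∀ q ∈ Q, u l q₀ ≤ u l q) → L' q₀ = l := by
        intro l hl hq
        obtain ⟨p, hp, rfl⟩ := hsurj l
        have hpQ : p ∈ Q := (Finset.mem_insert.1 hp).resolve_left (fun h => hl (h ▸ rfl))
        have : p = q₀ := hu _ (le_antisymm
          (hL' p hp q₀ (Finset.mem_insert_of_mem hq₀)) (hq p hpQ))
        rw [this]
      exact hij ((key _ h.1.symm (hL q₀ hq₀)).symm.trans (key _ h.2.symm hmin))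
    rcases hk with hk | hk
    · rw [hk] at hxM hxmax
      exact Or.inl (hu _ (le_antisymm (hm₁ x hxM) (hxmax _ hx₁)))
    · rw [hk] at hxM hxmax
      exact Or.inr (hu _ (le_antisymm (hm₂ x hxM) (hxmax _ hx₂)))
  · rintro (rfl | rfl)
    · refine hback _ _ (fun q hq => ?_) hx₁ hm₁
      by_cases h : q = q₀
      · exact ⟨j, hij.symm, h ▸ hmin⟩
      · exact ⟨L q, fun h' => h (hLinj hq hq₀ h'), hL q hq⟩
    · refine hback _ _ (fun q hq => ⟨L q, fun h => ?_, hL q hq⟩) hx₂ hm₂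
      exact hj (h ▸ Finset.mem_image_of_mem L hq)

/-- **Scarf's combinatorial lemma** for a family of orders with one slack point per order. -/
theorem exists_dominated_colorful {u : I → V → α} (hu : ∀ i, Function.Injective (u i))
    {s : I → V} (hbot : ∀ k v, u k (s k) ≤ u k v)
    (htop : ∀ k l, l ≠ k → ∀ t, t ∉ Set.range s → u l t < u l (s k))
    {t₀ : V} (ht₀ : t₀ ∉ Set.range s) {c : V → I} (hcs : ∀ k, c (s k) = k) (i₀ : I) :
    ∃ P : Finset V, Dominated u P ∧ P.image c = Finset.univ := by
  classical
  by_contra! hno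
  have hsinj : Function.Injective s := Function.LeftInverse.injective hcs
  set 𝒟 : Finset (Finset V) := Finset.univ.filter fun Q =>
    Q.card + 1 = Fintype.card I ∧ Q.image c = Finset.univ.erase i₀ ∧ Dominated u Q with h𝒟
  set ℛ : Finset (Finset V) := Finset.univ.filter fun P =>
    P.card = Fintype.card I ∧ Dominated u P with hℛ
  have hdc := Finset.sum_card_bipartiteAbove_eq_sum_card_bipartiteBelow (s := 𝒟) (t := ℛ)
    (fun Q P : Finset V => Q ⊆ P)
  have heven : Even (∑ P ∈ ℛ, (𝒟.bipartiteBelow (fun Q P : Finset V => Q ⊆ P) P).card) := by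
    refine Finset.even_sum _ fun P hP => ?_
    simp only [hℛ, Finset.mem_filter, Finset.mem_univ, true_and] at hP
    refine even_card_facets c i₀ hP.1 (hno P hP.2) fun Q => ?_
    simp only [Finset.bipartiteBelow, h𝒟, Finset.mem_filter, Finset.mem_univ, true_and]
    exact ⟨fun h => ⟨h.2, h.1.1, h.1.2.1⟩, fun h => ⟨⟨h.2.1, h.2.2, hP.2.mono h.1⟩, h.1⟩⟩
  have habove : ∀ Q ∈ 𝒟, ∀ P, P ∈ ℛ.bipartiteAbove (fun Q P : Finset V => Q ⊆ P) Q ↔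
      ∃ x, (x ∉ Q ∧ Dominated u (insert x Q)) ∧ P = insert x Q := by
    intro Q hQ P
    simp only [h𝒟, Finset.mem_filter, Finset.mem_univ, true_and] at hQ
    simp only [Finset.bipartiteAbove, hℛ, Finset.mem_filter, Finset.mem_univ, true_and]
    constructor
    · rintro ⟨⟨h1, h2⟩, h3⟩
      obtain ⟨x, hx, rfl⟩ := Finset.exists_eq_insert_iff.2 ⟨h3, by omega⟩
      exact ⟨x, ⟨hx, h2⟩, rfl⟩
    · rintro ⟨x, ⟨hx, hd⟩, rfl⟩
      exact ⟨⟨by rw [Finset.card_insert_of_notMem hx, hQ.1], hd⟩, Finset.subset_insert _ _⟩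
  have htwo : ∀ Q ∈ 𝒟, Q ≠ (Finset.univ.erase i₀).image s →
      Even (ℛ.bipartiteAbove (fun Q P : Finset V => Q ⊆ P) Q).card := by
    intro Q hQ hQ0
    have hQ' := hQ
    simp only [h𝒟, Finset.mem_filter, Finset.mem_univ, true_and] at hQ'
    obtain ⟨hcard, himg, hdom⟩ := hQ'
    obtain ⟨t, htQ, ht⟩ : ∃ t ∈ Q, t ∉ Set.range s := by
      by_contra! h
      refine hQ0 ?_
      rw [← himg, Finset.image_image]
      have : Set.EqOn (s ∘ c) id Q := by
        intro q hq
        obtain ⟨k, rfl⟩ := h q hq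
        simp [hcs]
      rw [Finset.image_congr this, Finset.image_id]
    obtain ⟨x₁, x₂, hne, hiff⟩ := hdom.exists_pivots hu hcard ⟨t, htQ⟩
      fun k => ⟨s k, fun l hl => ⟨t, htQ, htop k l hl t ht⟩⟩
    have : ℛ.bipartiteAbove (fun Q P : Finset V => Q ⊆ P) Q = {insert x₁ Q, insert x₂ Q} := by
      ext P
      rw [habove Q hQ]
      simp only [hiff, Finset.mem_insert, Finset.mem_singleton]
      exact ⟨by rintro ⟨x, rfl | rfl, rfl⟩ <;> simp,
        by rintro (h | h); exacts [⟨x₁, Or.inl rfl, h⟩, ⟨x₂, Or.inr rfl, h⟩]⟩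
    rw [this, Finset.card_pair]
    · exact even_two
    · intro h
      have h1 := ((hiff x₁).2 (Or.inl rfl)).1
      have h2 : x₁ ∈ insert x₂ Q := h ▸ Finset.mem_insert_self _ _
      exact (Finset.mem_insert.1 h2).elim hne h1
  have hspecial : (Finset.univ.erase i₀).image s ∈ 𝒟 := by
    simp only [h𝒟, Finset.mem_filter, Finset.mem_univ, true_and]
    refine ⟨?_, ?_, fun y => ?_⟩
    · rw [Finset.card_image_of_injective _ hsinj, Finset.card_erase_of_mem (Finset.mem_univ _),
        Finset.card_univ]
      have : 0 < Fintype.card I := Fintype.card_pos_iff.2 ⟨i₀⟩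
      omega
    · rw [Finset.image_image]
      rw [show c ∘ s = id from funext hcs, Finset.image_id]
    · by_cases hy : y ∈ Set.range s
      · obtain ⟨k, rfl⟩ := hy
        exact ⟨k, fun x _ => hbot k x⟩
      · refine ⟨i₀, fun x hx => ?_⟩
        obtain ⟨k, hk, rfl⟩ := Finset.mem_image.1 hx
        exact (htop k i₀ (Finset.ne_of_mem_erase hk).symm y hy).le
  have hone : (ℛ.bipartiteAbove (fun Q P : Finset V => Q ⊆ P)
      ((Finset.univ.erase i₀).image s)).card = 1 := by
    obtain ⟨x, hx, hxm⟩ := (Finset.univ.filter fun t => t ∉ Set.range s).exists_max_image (u i₀)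
      ⟨t₀, by simpa using ht₀⟩
    replace hx : x ∉ Set.range s := by simpa using hx
    replace hxm : ∀ t, t ∉ Set.range s → u i₀ t ≤ u i₀ x :=
      fun t ht => hxm t (by simpa using ht)
    refine Finset.card_eq_one.2 ⟨insert x ((Finset.univ.erase i₀).image s), ?_⟩
    ext P
    rw [habove _ hspecial, Finset.mem_singleton]
    constructor
    · rintro ⟨z, ⟨hz, hd⟩, rfl⟩
      have hslack : ∀ l, l ≠ i₀ → s l ∈ insert z ((Finset.univ.erase i₀).image s) := fun l hl =>
        Finset.mem_insert_of_mem (Finset.mem_image_of_mem _ (by simpa using hl))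
      have hdl : ∀ t, t ∉ Set.range s → u i₀ t ≤ u i₀ z := by
        intro t ht
        obtain ⟨l, hl⟩ := hd t
        by_cases h : l = i₀
        · exact h ▸ hl z (Finset.mem_insert_self _ _)
        · exact absurd ⟨l, hu l (le_antisymm (hbot l t) (hl _ (hslack l h)))⟩ ht
      have hzs : z ∉ Set.range s := by
        rintro ⟨k, rfl⟩
        have hk : k = i₀ := by
          by_contra h
          exact hz (Finset.mem_image_of_mem _ (by simpa using h))
        subst hk
        exact ht₀ ⟨k, hu k (le_antisymm (hbot k t₀) (hdl t₀ ht₀))⟩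
      rw [hu i₀ (le_antisymm (hxm z hzs) (hdl x hx))]
    · rintro rfl
      refine ⟨x, ⟨fun h => ?_, fun y => ?_⟩, rfl⟩
      · obtain ⟨k, -, hk⟩ := Finset.mem_image.1 h
        exact hx ⟨k, hk⟩
      · by_cases hy : y ∈ Set.range s
        · obtain ⟨k, rfl⟩ := hy
          exact ⟨k, fun x _ => hbot k x⟩
        · refine ⟨i₀, fun z hz => ?_⟩
          rcases Finset.mem_insert.1 hz with rfl | hz
          · exact hxm y hy
          · obtain ⟨k, hk, rfl⟩ := Finset.mem_image.1 hz
            exact (htop k i₀ (Finset.ne_of_mem_erase hk).symm y hy).le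
  rw [← hdc, ← Finset.add_sum_erase _ _ hspecial, hone] at heven
  have hrest := Finset.even_sum (s := 𝒟.erase ((Finset.univ.erase i₀).image s))
    (fun Q => (ℛ.bipartiteAbove (fun Q P : Finset V => Q ⊆ P) Q).card)
    fun Q hQ => htwo Q (Finset.mem_of_mem_erase hQ) (Finset.ne_of_mem_erase hQ)
  rw [Nat.even_add] at heven
  exact Nat.not_even_one (heven.2 hrest)

end Scarf

section Brouwer

/-- Scarf's lemma on the grid `{x : I → ℕ | ∑ i, x i = m}`: for every colouring of the grid there
are a set of colours `C` and representatives of these colours that lie within distance `card I`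
of each other and have small coordinates outside `C`. -/
theorem exists_colorful_grid_cell {I : Type*} [Fintype I] [DecidableEq I] [Nonempty I] (m : ℕ)
    (c : (I → ℕ) → I) :
    ∃ (x : I → ℕ) (C : Finset I), ∑ i, x i = m ∧ (∀ i ∉ C, x i ≤ Fintype.card I) ∧
      ∀ i ∈ C, ∃ y : I → ℕ, ∑ k, y k = m ∧ c y = i ∧
        ∀ k, x k ≤ y k + Fintype.card I ∧ y k ≤ x k + Fintype.card I := by
  classical
  obtain ⟨i₀⟩ := ‹Nonempty I›
  let T := {x // x ∈ Fintype.piFinset (fun _ : I => Finset.range (m + 1)) ∧ ∑ i, x i = m}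
  have hT : ∀ x : I → ℕ, ∑ i, x i = m →
      x ∈ Fintype.piFinset (fun _ : I => Finset.range (m + 1)) ∧ ∑ i, x i = m := by
    refine fun x hx => ⟨Fintype.mem_piFinset.2 fun i => Finset.mem_range_succ_iff.2 ?_, hx⟩
    exact hx ▸ Finset.single_le_sum (fun _ _ => Nat.zero_le _) (Finset.mem_univ i)
  have : Finite T := Set.Finite.to_subtype
    ((Fintype.piFinset (fun _ : I => Finset.range (m + 1))).finite_toSet.subset fun x hx => hx.1)
  let _ : Fintype T := Fintype.ofFinite T
  let e := Fintype.equivFin (T ⊕ I)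
  let w : I → T ⊕ I → ℕ := fun i =>
    Sum.elim (fun x => x.1 i + 1) (fun k => if k = i then 0 else m + 2)
  let u : I → T ⊕ I → ℕ ×ₗ Fin (Fintype.card (T ⊕ I)) := fun i v => toLex (w i v, e v)
  have hlt : ∀ i v v', w i v < w i v' → u i v < u i v' := fun i v v' h =>
    Prod.Lex.toLex_lt_toLex.2 (Or.inl h)
  have hle : ∀ i v v', u i v ≤ u i v' → w i v ≤ w i v' := fun i v v' h =>
    not_lt.1 fun h' => absurd (hlt i v' v h') (not_lt.2 h)
  have hxm : ∀ (x : T) i, x.1 i ≤ m := fun x i =>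
    Finset.mem_range_succ_iff.1 (Fintype.mem_piFinset.1 x.2.1 i)
  have hnot : ∀ v : T ⊕ I, v ∉ Set.range (Sum.inr : I → T ⊕ I) → ∃ x : T, v = Sum.inl x := by
    rintro (x | k) h
    · exact ⟨x, rfl⟩
    · exact absurd ⟨k, rfl⟩ h
  obtain ⟨P, hP, hPc⟩ := exists_dominated_colorful (u := u) (s := Sum.inr)
    (fun i v v' h => e.injective (congrArg (fun p => (ofLex p).2) h))
    (fun k v => by
      by_cases h : v = Sum.inr k
      · rw [h]
      refine (hlt k _ _ ?_).le
      rcases v with x | l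
      · simp [w]
      · have : l ≠ k := fun h' => h (h' ▸ rfl)
        simp [w, this])
    (fun k l hl t ht => by
      obtain ⟨x, rfl⟩ := hnot t ht
      refine hlt l _ _ ?_
      have := hxm x l
      simp only [w, Sum.elim_inl, Sum.elim_inr, if_neg hl.symm]
      omega)
    (t₀ := Sum.inl ⟨Pi.single i₀ m, hT _ (by simp)⟩) (by simp)
    (c := Sum.elim (fun x => c x.1) id) (fun k => rfl) i₀
  let C : Finset I := Finset.univ.filter fun i => Sum.inr i ∉ P
  have hC : ∀ i, i ∈ C ↔ Sum.inr i ∉ P := fun i => by simp [C]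
  let σ : Finset T := Finset.univ.filter fun x => Sum.inl x ∈ P
  have hσ : ∀ x, x ∈ σ ↔ Sum.inl x ∈ P := fun x => by simp [σ]
  have hcol : ∀ i ∈ C, ∃ x ∈ σ, c x.1 = i := by
    intro i hi
    obtain ⟨p, hp, hpi⟩ := Finset.mem_image.1 (hPc ▸ Finset.mem_univ i)
    rcases p with x | k
    · exact ⟨x, (hσ x).2 hp, hpi⟩
    · exact absurd ((show k = i from hpi) ▸ hp) ((hC i).1 hi)
  have hdom : ∀ y : I → ℕ, ∑ i, y i = m → ∃ i ∈ C, ∀ x ∈ σ, y i ≤ x.1 i := by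
    intro y hy
    obtain ⟨i, hi⟩ := hP (Sum.inl ⟨y, hT y hy⟩)
    refine ⟨i, (hC i).2 fun h => ?_, fun x hx => ?_⟩
    · simpa [w] using hle i _ _ (hi _ h)
    · simpa [w] using hle i _ _ (hi _ ((hσ x).1 hx))
  obtain ⟨j, hjC, -⟩ := hdom (Pi.single i₀ m) (by simp)
  obtain ⟨x₀, hx₀, -⟩ := hcol j hjC
  have hmn : ∀ i, ∃ b, (∃ x ∈ σ, x.1 i = b) ∧ ∀ x ∈ σ, b ≤ x.1 i := by
    intro i
    obtain ⟨x, hx, h⟩ := σ.exists_min_image (fun x => x.1 i) ⟨x₀, hx₀⟩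
    exact ⟨_, ⟨x, hx, rfl⟩, h⟩
  choose mn hmn₁ hmn₂ using hmn
  have hbig : m < ∑ i ∈ C, (mn i + 1) := by
    by_contra! h
    obtain ⟨i, hi, hi'⟩ := hdom
      (fun i => (if i ∈ C then mn i + 1 else 0) +
        (if i = j then m - ∑ i ∈ C, (mn i + 1) else 0)) (by
        rw [Finset.sum_add_distrib, Finset.sum_ite_mem, Finset.univ_inter,
          Finset.sum_ite_eq' Finset.univ j, if_pos (Finset.mem_univ _)]
        omega)
    obtain ⟨x, hx, hxi⟩ := hmn₁ i
    have := hi' x hx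
    simp only [if_pos hi] at this
    omega
  rw [Finset.sum_add_distrib, Finset.sum_const, smul_eq_mul, mul_one] at hbig
  have hCn : C.card ≤ Fintype.card I := Finset.card_le_univ C
  have hup : ∀ x ∈ σ, ∀ i ∈ C, x.1 i ≤ mn i + Fintype.card I := by
    intro x hx i hi
    have h1 : ∑ k ∈ C, x.1 k ≤ m :=
      (Finset.sum_le_sum_of_subset (Finset.subset_univ _)).trans_eq x.2.2
    have h2 : ∑ k ∈ C.erase i, mn k ≤ ∑ k ∈ C.erase i, x.1 k :=
      Finset.sum_le_sum fun k _ => hmn₂ k x hx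
    rw [← Finset.add_sum_erase _ _ hi] at h1 hbig
    omega
  have hout : ∀ x ∈ σ, ∀ i ∉ C, x.1 i ≤ Fintype.card I := by
    intro x hx i hi
    have h1 : ∑ k ∈ insert i C, x.1 k ≤ m :=
      (Finset.sum_le_sum_of_subset (Finset.subset_univ _)).trans_eq x.2.2
    have h2 : ∑ k ∈ C, mn k ≤ ∑ k ∈ C, x.1 k := Finset.sum_le_sum fun k _ => hmn₂ k x hx
    rw [Finset.sum_insert hi] at h1
    omega
  have hclose : ∀ x ∈ σ, ∀ y ∈ σ, ∀ k, x.1 k ≤ y.1 k + Fintype.card I := by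
    intro x hx y hy k
    by_cases hk : k ∈ C
    · have := hup x hx k hk
      have := hmn₂ k y hy
      omega
    · have := hout x hx k hk
      omega
  refine ⟨x₀.1, C, x₀.2.2, hout x₀ hx₀, fun i hi => ?_⟩
  obtain ⟨y, hy, hyi⟩ := hcol i hi
  exact ⟨y.1, y.2.2, hyi, fun k => ⟨hclose _ hx₀ _ hy k, hclose _ hy _ hx₀ k⟩⟩

/-- **Brouwer's fixed point theorem** on the standard simplex. -/
theorem exists_fixed_point_stdSimplex {I : Type*} [Fintype I] [Nonempty I]
    {f : (I → ℝ) → I → ℝ} (hf : ContinuousOn f (stdSimplex ℝ I))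
    (hmaps : Set.MapsTo f (stdSimplex ℝ I) (stdSimplex ℝ I)) :
    ∃ z ∈ stdSimplex ℝ I, f z = z := by
  classical
  have hcpt : IsCompact (stdSimplex ℝ I) := isCompact_stdSimplex ℝ I
  have hcol : ∀ z ∈ stdSimplex ℝ I, ∃ i, z i ≤ f z i := by
    intro z hz
    by_contra! h
    have := Finset.sum_lt_sum_of_nonempty Finset.univ_nonempty fun i _ => h i
    rw [hz.2, (hmaps hz).2] at this
    exact lt_irrefl _ this
  have happrox : ∀ ε > 0, ∃ z ∈ stdSimplex ℝ I, ∀ i, z i ≤ f z i + ε := by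
    intro ε hε
    obtain ⟨δ, hδ, hunif⟩ := Metric.uniformContinuousOn_iff.1
      (hcpt.uniformContinuousOn_of_continuous hf) (ε / 2) (half_pos hε)
    set n := Fintype.card I
    obtain ⟨m, hm⟩ := exists_nat_gt (n / min δ (ε / 2))
    have hmin : 0 < min δ (ε / 2) := lt_min hδ (half_pos hε)
    have hm0 : (0 : ℝ) < m := lt_of_le_of_lt (by positivity) hm
    have hnm : (n : ℝ) / m < min δ (ε / 2) := by
      rw [div_lt_iff₀ hmin] at hm
      rw [div_lt_iff₀ hm0]
      linarith
    have hgrid : ∀ x : I → ℕ, ∑ i, x i = m → (fun i => (x i : ℝ) / m) ∈ stdSimplex ℝ I := by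
      refine fun x hx => ⟨fun i => by positivity, ?_⟩
      rw [← Finset.sum_div, ← Nat.cast_sum, hx, div_self hm0.ne']
    have hcol' : ∀ x : I → ℕ, ∃ i, ∑ i, x i = m →
        (x i : ℝ) / m ≤ f (fun i => (x i : ℝ) / m) i := by
      intro x
      by_cases hx : ∑ i, x i = m
      · obtain ⟨i, hi⟩ := hcol _ (hgrid x hx)
        exact ⟨i, fun _ => hi⟩
      · exact ⟨Classical.arbitrary I, fun h => absurd h hx⟩
    choose c hc using hcol'
    obtain ⟨x, C, hx, hout, hin⟩ := exists_colorful_grid_cell m c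
    refine ⟨_, hgrid x hx, fun i => ?_⟩
    by_cases hi : i ∈ C
    · obtain ⟨y, hy, rfl, hxy⟩ := hin i hi
      have hd : ∀ k, (x k : ℝ) / m ≤ y k / m + n / m ∧ (y k : ℝ) / m ≤ x k / m + n / m := by
        intro k
        rw [← add_div, ← add_div]
        constructor <;> gcongr
        · exact_mod_cast (hxy k).1
        · exact_mod_cast (hxy k).2
      have hdist : dist (fun i => (x i : ℝ) / m) (fun i => (y i : ℝ) / m) < δ := by
        refine (dist_pi_lt_iff hδ).2 fun k => ?_
        rw [Real.dist_eq, abs_lt]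
        have := hd k
        have := hnm.trans_le (min_le_left _ _)
        constructor <;> linarith
      have h1 := (dist_pi_lt_iff (half_pos hε)).1 (hunif _ (hgrid x hx) _ (hgrid y hy) hdist) (c y)
      rw [Real.dist_eq, abs_lt] at h1
      have h2 := hc y hy
      have h3 := (hd (c y)).1
      have := hnm.trans_le (min_le_right _ _)
      linarith
    · have h1 : (x i : ℝ) / m ≤ n / m := by
        gcongr
        exact_mod_cast hout i hi
      have h2 := (hmaps (hgrid x hx)).1 i
      have := hnm.trans_le (min_le_right _ _)
      linarith
  have hne : (stdSimplex ℝ I).Nonempty := (happrox 1 one_pos).imp fun _ h => h.1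
  have hgc : ContinuousOn (fun z => ∑ i, max 0 (z i - f z i)) (stdSimplex ℝ I) := by
    refine continuousOn_finsetSum _ fun i _ => ?_
    have h1 : ContinuousOn (fun z => f z i) (stdSimplex ℝ I) := continuousOn_pi.1 hf i
    exact (continuous_const.max continuous_id).comp_continuousOn
      ((continuous_apply i).continuousOn.sub h1)
  obtain ⟨z, hz, hmin⟩ := hcpt.exists_isMinOn hne hgc
  have hnonpos : ∑ i, max 0 (z i - f z i) ≤ 0 := by
    refine le_of_forall_pos_le_add fun ε hε => ?_
    have hn : (0 : ℝ) < Fintype.card I := by exact_mod_cast Fintype.card_pos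
    obtain ⟨z', hz', h⟩ := happrox (ε / Fintype.card I) (by positivity)
    calc ∑ i, max 0 (z i - f z i) ≤ ∑ i, max 0 (z' i - f z' i) := hmin hz'
      _ ≤ ∑ _i : I, ε / Fintype.card I := by
        refine Finset.sum_le_sum fun i _ => max_le (by positivity) ?_
        have := h i
        linarith
      _ = 0 + ε := by
        rw [Finset.sum_const, Finset.card_univ, nsmul_eq_mul]
        field_simp
        ring
  have hle : ∀ i ∈ Finset.univ, z i ≤ f z i := by
    intro i hi
    have h1 := Finset.single_le_sum (f := fun i => max 0 (z i - f z i))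
      (fun i _ => le_max_left _ _) hi
    have h2 := le_max_right 0 (z i - f z i)
    linarith
  refine ⟨z, hz, funext fun i => ?_⟩
  exact ((Finset.sum_eq_sum_iff_of_le hle).1 (by rw [hz.2, (hmaps hz).2]) i
    (Finset.mem_univ i)).symm

/-- **Brouwer's fixed point theorem** on a finite product of copies of a standard simplex. -/
theorem exists_fixed_point_pi_stdSimplex {J A : Type*} [Fintype J] [Fintype A] [Nonempty A]
    {f : (J → A → ℝ) → J → A → ℝ}
    (hf : ContinuousOn f {x | ∀ j, x j ∈ stdSimplex ℝ A})
    (hmaps : ∀ x, (∀ j, x j ∈ stdSimplex ℝ A) → ∀ j, f x j ∈ stdSimplex ℝ A) :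
    ∃ x, (∀ j, x j ∈ stdSimplex ℝ A) ∧ f x = x := by
  rcases isEmpty_or_nonempty J with hJ | hJ
  · exact ⟨fun _ _ => 0, fun j => hJ.elim j, Subsingleton.elim _ _⟩
  set n : ℝ := (Fintype.card J : ℝ)
  set a : ℝ := (Fintype.card A : ℝ)
  have hn : 0 < n := by simp only [n]; exact_mod_cast Fintype.card_pos
  have ha : 0 < a := by simp only [a]; exact_mod_cast Fintype.card_pos
  let ρ : (J × A → ℝ) → J → A → ℝ := fun y j b =>
    (y (j, b) + max 0 (1 / n - ∑ b', y (j, b')) / a) / max (1 / n) (∑ b', y (j, b'))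
  let ι : (J → A → ℝ) → J × A → ℝ := fun x p => x p.1 p.2 / n
  have hpos : ∀ (y : J × A → ℝ) j, 0 < max (1 / n) (∑ b', y (j, b')) := fun y j =>
    lt_max_of_lt_left (by positivity)
  have hρ : ∀ y ∈ stdSimplex ℝ (J × A), ∀ j, ρ y j ∈ stdSimplex ℝ A := by
    intro y hy j
    refine ⟨fun b => div_nonneg (add_nonneg (hy.1 _) ?_) (hpos y j).le, ?_⟩
    · exact div_nonneg (le_max_left _ _) ha.le
    · simp only [ρ]
      rw [← Finset.sum_div, div_eq_one_iff_eq (hpos y j).ne', Finset.sum_add_distrib,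
        Finset.sum_const, Finset.card_univ, nsmul_eq_mul, mul_div_cancel₀ _ ha.ne']
      rcases le_total (1 / n) (∑ b', y (j, b')) with h | h
      · rw [max_eq_right h, max_eq_left (by linarith), add_zero]
      · rw [max_eq_left h, max_eq_right (by linarith)]; ring
  have hι : ∀ x, (∀ j, x j ∈ stdSimplex ℝ A) → ι x ∈ stdSimplex ℝ (J × A) := by
    intro x hx
    refine ⟨fun p => div_nonneg ((hx p.1).1 p.2) hn.le, ?_⟩
    simp only [ι]
    rw [← Finset.sum_div, Fintype.sum_prod_type, Finset.sum_congr rfl fun j _ => (hx j).2,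
      Finset.sum_const, Finset.card_univ, nsmul_eq_mul, mul_one, div_self hn.ne']
  have hρι : ∀ x, (∀ j, x j ∈ stdSimplex ℝ A) → ρ (ι x) = x := by
    intro x hx
    funext j b
    simp only [ρ, ι]
    rw [← Finset.sum_div, (hx j).2, max_self, sub_self, max_self]
    field_simp
    ring
  have hρc : Continuous ρ := by
    refine continuous_pi fun j => continuous_pi fun b => Continuous.div ?_ ?_ fun y => (hpos y j).ne'
    · fun_prop
    · fun_prop
  have hιc : Continuous ι := by fun_prop
  obtain ⟨y, hy, hfix⟩ := exists_fixed_point_stdSimplex (f := fun y => ι (f (ρ y)))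
    (hιc.comp_continuousOn (hf.comp hρc.continuousOn hρ)) (fun y hy => hι _ (hmaps _ (hρ y hy)))
  refine ⟨ρ y, hρ y hy, ?_⟩
  have := congrArg ρ hfix
  rwa [hρι _ (hmaps _ (hρ y hy))] at this

end Brouwer

section PolicyAware

variable {S A : Type*} [Fintype S] [Fintype A]

/-- State value, with `k` steps to go before the horizon `H`, of executing `π` in the policy-aware
model frozen by `π` itself. -/
def valPam (H : ℕ) (Pd : ℕ → S → A → (ℕ → S → A → ℝ) → S → ℝ)
    (rd : ℕ → S → A → (ℕ → S → A → ℝ) → ℝ) (π : ℕ → S → A → ℝ) : ℕ → S → ℝ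
  | 0 => 0
  | k + 1 => fun s => ∑ a, π (H - (k + 1)) s a *
      (rd (H - (k + 1)) s a π + ∑ s', Pd (H - (k + 1)) s a π s' * valPam H Pd rd π k s')

/-- State-action value at step `h` of executing `π` in the policy-aware model frozen by `π`. -/
def qvalPam (H : ℕ) (Pd : ℕ → S → A → (ℕ → S → A → ℝ) → S → ℝ)
    (rd : ℕ → S → A → (ℕ → S → A → ℝ) → ℝ) (π : ℕ → S → A → ℝ) (h : ℕ) (s : S) (a : A) : ℝ :=
  rd h s a π + ∑ s', Pd h s a π s' * valPam H Pd rd π (H - (h + 1)) s'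

variable {H : ℕ} {Pd : ℕ → S → A → (ℕ → S → A → ℝ) → S → ℝ}
  {rd : ℕ → S → A → (ℕ → S → A → ℝ) → ℝ} {μ₁ : S → ℝ}

theorem valPam_eq_sum_qvalPam (π : ℕ → S → A → ℝ) {h : ℕ} (hh : h < H) (s : S) :
    valPam H Pd rd π (H - h) s = ∑ a, π h s a * qvalPam H Pd rd π h s a := by
  obtain ⟨k, hk⟩ : ∃ k, H - h = k + 1 := ⟨H - h - 1, by omega⟩
  have h1 : H - (k + 1) = h := by omega
  have h2 : H - (h + 1) = k := by omega
  simp only [hk, valPam, qvalPam, h1, h2]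

theorem densPam_nonneg (hμ₁ : ∀ s, 0 ≤ μ₁ s) {π πt : ℕ → S → A → ℝ}
    (hPd : ∀ h, h < H → ∀ s a s', 0 ≤ Pd h s a π s') (hπt : IsPolicy πt) :
    ∀ h, h ≤ H → ∀ s, 0 ≤ densPam Pd μ₁ π πt h s
  | 0, _, s => hμ₁ s
  | h + 1, hh, s' => Finset.sum_nonneg fun s _ => Finset.sum_nonneg fun a _ =>
      mul_nonneg (mul_nonneg (densPam_nonneg hμ₁ hPd hπt h (Nat.le_of_succ_le hh) s)
        ((hπt h s).1 a)) (hPd h hh s a s')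

/-- **Performance difference identity**: the return of `πt` exceeds the value of `π` by the
accumulated advantages of `πt` over `π`. -/
theorem Jpam_eq_add_sum_advantage (π πt : ℕ → S → A → ℝ) :
    Jpam H Pd rd μ₁ πt π = ∑ s, μ₁ s * valPam H Pd rd π H s +
      ∑ h ∈ Finset.range H, ∑ s, densPam Pd μ₁ π πt h s *
        (∑ a, πt h s a * qvalPam H Pd rd π h s a - valPam H Pd rd π (H - h) s) := by
  have hstep : ∀ h, ∑ s, ∑ a, densPam Pd μ₁ π πt h s * πt h s a * rd h s a π =
      ∑ s, densPam Pd μ₁ π πt h s *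
        (∑ a, πt h s a * qvalPam H Pd rd π h s a - valPam H Pd rd π (H - h) s) -
      (∑ s, densPam Pd μ₁ π πt (h + 1) s * valPam H Pd rd π (H - (h + 1)) s -
        ∑ s, densPam Pd μ₁ π πt h s * valPam H Pd rd π (H - h) s) := by
    intro h
    have hnext : ∑ s', densPam Pd μ₁ π πt (h + 1) s' * valPam H Pd rd π (H - (h + 1)) s' =
        ∑ s, ∑ a, densPam Pd μ₁ π πt h s * πt h s a *
          ∑ s', Pd h s a π s' * valPam H Pd rd π (H - (h + 1)) s' := by
      simp only [densPam, Finset.sum_mul, Finset.mul_sum]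
      rw [Finset.sum_comm]
      refine Finset.sum_congr rfl fun s _ => ?_
      rw [Finset.sum_comm]
      exact Finset.sum_congr rfl fun a _ => Finset.sum_congr rfl fun s' _ => by ring
    rw [hnext]
    simp only [← Finset.sum_sub_distrib]
    refine Finset.sum_congr rfl fun s _ => ?_
    simp only [qvalPam, mul_add, Finset.sum_add_distrib, mul_sub, Finset.mul_sum, mul_assoc]
    ring
  rw [Jpam, Finset.sum_congr rfl fun h _ => hstep h, Finset.sum_sub_distrib,
    Finset.sum_range_sub (fun h => ∑ s, densPam Pd μ₁ π πt h s * valPam H Pd rd π (H - h) s)]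
  simp [valPam, densPam]
  ring

/-- A policy without profitable one-step deviations is a Nash equilibrium. -/
theorem Jpam_le_of_qvalPam_le (hμ₁ : ∀ s, 0 ≤ μ₁ s) {π : ℕ → S → A → ℝ}
    (hPd : ∀ h, h < H → ∀ s a s', 0 ≤ Pd h s a π s')
    (hq : ∀ h, h < H → ∀ s a, qvalPam H Pd rd π h s a ≤ valPam H Pd rd π (H - h) s)
    {πt : ℕ → S → A → ℝ} (hπt : IsPolicy πt) :
    Jpam H Pd rd μ₁ πt π ≤ Jpam H Pd rd μ₁ π π := by
  rw [Jpam_eq_add_sum_advantage π πt, Jpam_eq_add_sum_advantage π π]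
  refine add_le_add le_rfl (Finset.sum_le_sum fun h hh => Finset.sum_le_sum fun s _ => ?_)
  have hh := Finset.mem_range.1 hh
  rw [← valPam_eq_sum_qvalPam π hh, sub_self, mul_zero]
  refine mul_nonpos_of_nonneg_of_nonpos (densPam_nonneg hμ₁ hPd hπt h hh.le s) (sub_nonpos.2 ?_)
  calc ∑ a, πt h s a * qvalPam H Pd rd π h s a
      ≤ ∑ a, πt h s a * valPam H Pd rd π (H - h) s :=
        Finset.sum_le_sum fun a _ => mul_le_mul_of_nonneg_left (hq h hh s a) ((hπt h s).1 a)
    _ = valPam H Pd rd π (H - h) s := by rw [← Finset.sum_mul, (hπt h s).2, one_mul]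

/-- The policy that follows `x` before the horizon and the uniform distribution afterwards. -/
noncomputable def extendPolicy (H : ℕ) (x : Fin H × S → A → ℝ) : ℕ → S → A → ℝ :=
  fun h s a => if hh : h < H then x (⟨h, hh⟩, s) a else 1 / Fintype.card A

theorem isPolicy_extendPolicy {S A : Type*} [Fintype A] [Nonempty A] {H : ℕ}
    {x : Fin H × S → A → ℝ}
    (hx : ∀ j, x j ∈ stdSimplex ℝ A) : IsPolicy (extendPolicy H x) := by
  intro h s
  by_cases hh : h < H
  · simpa only [extendPolicy, hh, dite_true] using! hx (⟨h, hh⟩, s)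
  · simp only [extendPolicy, hh, dite_false]
    refine ⟨fun _ => by positivity, ?_⟩
    simp

/-- A function that is continuous with respect to the `d_{∞,1}` distance on policies is continuous
on the finite-dimensional space of policies up to the horizon. -/
theorem continuousOn_comp_extendPolicy [Nonempty A] {g : (ℕ → S → A → ℝ) → ℝ}
    (hg : ∀ π, IsPolicy π → ∀ ε : ℝ, 0 < ε → ∃ δ : ℝ, 0 < δ ∧
      ∀ π', IsPolicy π' → (∀ k, k < H → ∀ x, l1 (π k x) (π' k x) ≤ δ) → |g π - g π'| ≤ ε) :
    ContinuousOn (fun x : Fin H × S → A → ℝ => g (extendPolicy H x))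
      {x | ∀ j, x j ∈ stdSimplex ℝ A} := by
  refine Metric.continuousOn_iff.2 fun x hx ε hε => ?_
  obtain ⟨δ, hδ, h⟩ := hg _ (isPolicy_extendPolicy hx) (ε / 2) (half_pos hε)
  have hA : (0 : ℝ) < Fintype.card A := by exact_mod_cast Fintype.card_pos
  refine ⟨δ / Fintype.card A, by positivity, fun y hy hyx => ?_⟩
  rw [dist_comm, Real.dist_eq]
  refine lt_of_le_of_lt (h _ (isPolicy_extendPolicy hy) fun k hk s => ?_) (half_lt_self hε)
  calc l1 (extendPolicy H x k s) (extendPolicy H y k s)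
      ≤ ∑ _a : A, δ / Fintype.card A := by
        refine Finset.sum_le_sum fun a _ => ?_
        simp only [extendPolicy, hk, dite_true]
        rw [← Real.dist_eq, dist_comm]
        exact ((dist_le_pi_dist _ _ a).trans (dist_le_pi_dist y x (⟨k, hk⟩, s))).trans hyx.le
    _ = δ := by
        rw [Finset.sum_const, Finset.card_univ, nsmul_eq_mul]
        field_simp

theorem continuousOn_valPam {K : Set (Fin H × S → A → ℝ)}
    (hP : ∀ h, h < H → ∀ s a s', ContinuousOn (fun x => Pd h s a (extendPolicy H x) s') K)
    (hr : ∀ h, h < H → ∀ s a, ContinuousOn (fun x => rd h s a (extendPolicy H x)) K) :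
    ∀ k, k ≤ H → ∀ s, ContinuousOn (fun x => valPam H Pd rd (extendPolicy H x) k s) K
  | 0, _, _ => continuousOn_const
  | k + 1, hk, s => by
    have hlt : H - (k + 1) < H := by omega
    refine continuousOn_finsetSum _ fun a _ => ContinuousOn.mul ?_ ((hr _ hlt s a).add
      (continuousOn_finsetSum _ fun s' _ => (hP _ hlt s a s').mul
        (continuousOn_valPam hP hr k (Nat.le_of_succ_le hk) s')))
    simp only [extendPolicy, hlt, dite_true]
    fun_prop

theorem continuousOn_qvalPam {K : Set (Fin H × S → A → ℝ)}
    (hP : ∀ h, h < H → ∀ s a s', ContinuousOn (fun x => Pd h s a (extendPolicy H x) s') K)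
    (hr : ∀ h, h < H → ∀ s a, ContinuousOn (fun x => rd h s a (extendPolicy H x)) K)
    {h : ℕ} (hh : h < H) (s : S) (a : A) :
    ContinuousOn (fun x => qvalPam H Pd rd (extendPolicy H x) h s a) K :=
  (hr h hh s a).add (continuousOn_finsetSum _ fun s' _ => (hP h hh s a s').mul
    (continuousOn_valPam hP hr _ (by omega) s'))

end PolicyAware

/-- If the normalized update of the distribution `p` by the positive parts of `q - v` fixes `p`,
where `v` is the mean of `q` under `p`, then `q ≤ v`. -/
theorem le_mean_of_gain_update_eq {A : Type*} [Fintype A] {p q : A → ℝ} {v : ℝ}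
    (hp : p ∈ stdSimplex ℝ A) (hv : v = ∑ a, p a * q a)
    (hfix : ∀ a, (p a + max 0 (q a - v)) / (1 + ∑ b, max 0 (q b - v)) = p a) (a : A) :
    q a ≤ v := by
  set G := ∑ b, max 0 (q b - v) with hG
  have hG0 : 0 ≤ G := Finset.sum_nonneg fun _ _ => le_max_left _ _
  have hgain : ∀ b, max 0 (q b - v) = p b * G := by
    intro b
    have := hfix b
    rw [div_eq_iff (by positivity)] at this
    linarith
  have hzero : ∑ b, p b * (q b - v) = 0 := by
    simp only [mul_sub, Finset.sum_sub_distrib, ← Finset.sum_mul, hp.2, ← hv]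
    ring
  have hterm : ∀ b, 0 ≤ p b * G * (q b - v) := by
    intro b
    rw [← hgain b]
    rcases le_total 0 (q b - v) with h | h
    · rw [max_eq_right h]; exact mul_nonneg h h
    · rw [max_eq_left h, zero_mul]
  have hsum : ∑ b, p b * G * (q b - v) = 0 := by
    rw [← mul_zero G, ← hzero, Finset.mul_sum]
    exact Finset.sum_congr rfl fun b _ => by ring
  have ha := (Finset.sum_eq_zero_iff_of_nonneg fun b _ => hterm b).1 hsum a (Finset.mem_univ a)
  rw [← hgain a] at ha
  by_contra! h
  have hpos : 0 < q a - v := sub_pos.2 h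
  rw [max_eq_right hpos.le] at ha
  exact (mul_pos hpos hpos).ne' ha

/-- **Existence of Nash equilibrium in a policy-aware model.** If the
transition and reward functions of a PAM are continuous in the reference policy with respect
to the metric `d_{∞,1}`, then the PAM admits a Nash equilibrium. -/
theorem pam_NE_exists {S A : Type*} [Fintype S] [Fintype A] [Nonempty A] (H : ℕ)
    (Pd : ℕ → S → A → (ℕ → S → A → ℝ) → S → ℝ)
    (rd : ℕ → S → A → (ℕ → S → A → ℝ) → ℝ)
    (μ₁ : S → ℝ) (hμ₁ : μ₁ ∈ stdSimplex ℝ S)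
    (hPd : ∀ h, h < H → ∀ s a π, IsPolicy π → Pd h s a π ∈ stdSimplex ℝ S)
    (hrd : ∀ h, h < H → ∀ s a π, IsPolicy π → rd h s a π ∈ Set.Icc (0 : ℝ) (1 / (H : ℝ)))
    -- continuity of `π ↦ P̈_h(s'|s,a,π)` on `(Π, d_{∞,1})`
    (hPcont : ∀ h, h < H → ∀ s a s', ∀ π, IsPolicy π → ∀ ε : ℝ, 0 < ε → ∃ δ : ℝ, 0 < δ ∧
      ∀ π', IsPolicy π' → (∀ k, k < H → ∀ x, l1 (π k x) (π' k x) ≤ δ) →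
        |Pd h s a π s' - Pd h s a π' s'| ≤ ε)
    -- continuity of `π ↦ r̈_h(s,a,π)` on `(Π, d_{∞,1})`
    (hrcont : ∀ h, h < H → ∀ s a, ∀ π, IsPolicy π → ∀ ε : ℝ, 0 < ε → ∃ δ : ℝ, 0 < δ ∧
      ∀ π', IsPolicy π' → (∀ k, k < H → ∀ x, l1 (π k x) (π' k x) ≤ δ) →
        |rd h s a π - rd h s a π'| ≤ ε) :
    ∃ πstar : ℕ → S → A → ℝ, IsPolicy πstar ∧
      ∀ πt, IsPolicy πt → Jpam H Pd rd μ₁ πt πstar ≤ Jpam H Pd rd μ₁ πstar πstar := by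
  have hP : ∀ h, h < H → ∀ s a s', ContinuousOn
      (fun x : Fin H × S → A → ℝ => Pd h s a (extendPolicy H x) s')
      {x | ∀ j, x j ∈ stdSimplex ℝ A} := fun h hh s a s' =>
    continuousOn_comp_extendPolicy (g := fun π => Pd h s a π s') (hPcont h hh s a s')
  have hr : ∀ h, h < H → ∀ s a, ContinuousOn
      (fun x : Fin H × S → A → ℝ => rd h s a (extendPolicy H x))
      {x | ∀ j, x j ∈ stdSimplex ℝ A} := fun h hh s a =>
    continuousOn_comp_extendPolicy (hrcont h hh s a)
  let gain : (Fin H × S → A → ℝ) → Fin H × S → A → ℝ := fun x j a =>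
    max 0 (qvalPam H Pd rd (extendPolicy H x) j.1 j.2 a -
      valPam H Pd rd (extendPolicy H x) (H - j.1) j.2)
  have hgain₀ : ∀ x j a, 0 ≤ gain x j a := fun x j a => le_max_left _ _
  have hden : ∀ x j, 0 < 1 + ∑ b, gain x j b := fun x j =>
    add_pos_of_pos_of_nonneg one_pos (Finset.sum_nonneg fun b _ => hgain₀ x j b)
  have hgainc : ∀ j a, ContinuousOn (fun x => gain x j a) {x | ∀ j, x j ∈ stdSimplex ℝ A} :=
    fun j a => (continuous_const.max continuous_id).comp_continuousOn
      ((continuousOn_qvalPam hP hr j.1.2 j.2 a).sub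
        (continuousOn_valPam hP hr _ (Nat.sub_le _ _) j.2))
  obtain ⟨x, hx, hfix⟩ := exists_fixed_point_pi_stdSimplex
    (f := fun x j a => (x j a + gain x j a) / (1 + ∑ b, gain x j b))
    (continuousOn_pi.2 fun j => continuousOn_pi.2 fun a => ContinuousOn.div
      (ContinuousOn.add (by fun_prop) (hgainc j a))
      (continuousOn_const.add (continuousOn_finsetSum _ fun b _ => hgainc j b))
      fun x _ => (hden x j).ne')
    (fun x hx j => ⟨fun a => div_nonneg (add_nonneg ((hx j).1 a) (hgain₀ x j a)) (hden x j).le, by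
      rw [← Finset.sum_div, Finset.sum_add_distrib, (hx j).2, div_self (hden x j).ne']⟩)
  have hpol := isPolicy_extendPolicy hx
  refine ⟨extendPolicy H x, hpol, fun πt hπt => Jpam_le_of_qvalPam_le hμ₁.1
    (fun h hh s a => (hPd h hh s a _ hpol).1) (fun h hh s => ?_) hπt⟩
  refine le_mean_of_gain_update_eq (hx (⟨h, hh⟩, s)) ?_
    fun a => congrFun (congrFun hfix (⟨h, hh⟩, s)) a
  rw [valPam_eq_sum_qvalPam _ hh]
  simp [extendPolicy, hh]
end

section
/- Let 𝐌 be a multi-type mean-field MDP with W types satisfying the Lipschitz continuity assumption: there are L_T, L_r ≥ 0 such that for all 𝛑, 𝛑̃ ∈ 𝚷 and all w, h, s, a: ‖P^w_h(·|s,a,𝛍^𝛑_{𝐌,h}) − P^w_h(·|s,a,𝛍^𝛑̃_{𝐌,h})‖₁ ≤ (L_T/W)·‖𝛍^𝛑_{𝐌,h} − 𝛍^𝛑̃_{𝐌,h}‖₁ and |r^w_h(s,a,𝛍^𝛑_{𝐌,h}) − r^w_h(s,a,𝛍^𝛑̃_{𝐌,h})| ≤ (L_r/W)·‖𝛍^𝛑_{𝐌,h}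 − 𝛍^𝛑̃_{𝐌,h}‖₁. Then 𝐌 has at least one Nash equilibrium: there exists 𝛑^NE ∈ 𝚷 such that for all w ∈ {1,…,W} and all 𝛑̃ ∈ 𝚷, J^w_𝐌(𝛑̃;𝛑^NE) ≤ J^w_𝐌(𝛑^NE;𝛑^NE). -/
/-- A multi-type policy: for each type `w`, step `h` and state `s`, a distribution over
the type-`w` actions. -/
def IsPolicyMT {W : ℕ} {S A : Fin W → Type*} [∀ w, Fintype (A w)]
    (π : ∀ w, ℕ → S w → A w → ℝ) : Prop :=
  ∀ w h s, (∀ a, 0 ≤ π w h s a) ∧ ∑ a, π w h s a = 1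

/-- Multi-type kernels: for each type `w` and step `h < H`, a probability distribution on
`S w` given a tuple of densities, one per type. -/
def IsKernelMT {W : ℕ} {S A : Fin W → Type*} [∀ w, Fintype (S w)] (H : ℕ)
    (P : ∀ w, ℕ → S w → A w → (∀ w', S w' → ℝ) → S w → ℝ) : Prop :=
  ∀ w h, h < H → ∀ s a (μ : ∀ w', S w' → ℝ),
    (∀ w', μ w' ∈ stdSimplex ℝ (S w')) → P w h s a μ ∈ stdSimplex ℝ (S w)

/-- Induced multi-type state densities: `densMT P μ₁ π h w = μ^{w,𝛑}_{𝐌,h+1}`. -/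
def densMT {W : ℕ} {S A : Fin W → Type*} [∀ w, Fintype (S w)] [∀ w, Fintype (A w)]
    (P : ∀ w, ℕ → S w → A w → (∀ w', S w' → ℝ) → S w → ℝ)
    (μ₁ : ∀ w, S w → ℝ) (π : ∀ w, ℕ → S w → A w → ℝ) : ℕ → ∀ w, S w → ℝ
  | 0 => μ₁
  | h + 1 => fun w s' =>
      ∑ s, ∑ a, densMT P μ₁ π h w s * π w h s a * P w h s a (densMT P μ₁ π h) s'

/-- State law of a type-`w` agent executing `π̃^w` while the type-`w` kernels are frozen at
the densities induced by the reference policy `π`. -/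
def densWF {W : ℕ} {S A : Fin W → Type*} [∀ w, Fintype (S w)] [∀ w, Fintype (A w)]
    (P : ∀ w, ℕ → S w → A w → (∀ w', S w' → ℝ) → S w → ℝ)
    (μ₁ : ∀ w, S w → ℝ) (π πt : ∀ w, ℕ → S w → A w → ℝ) (w : Fin W) : ℕ → S w → ℝ
  | 0 => μ₁ w
  | h + 1 => fun s' =>
      ∑ s, ∑ a, densWF P μ₁ π πt w h s * πt w h s a * P w h s a (densMT P μ₁ π h) s'

/-- `J^w_𝐌(π̃;π)`: expected total type-`w` reward of executing `π̃` while the type-`w`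
transitions and rewards are frozen at the densities induced by `π`. -/
def JMT {W : ℕ} {S A : Fin W → Type*} [∀ w, Fintype (S w)] [∀ w, Fintype (A w)] (H : ℕ)
    (P : ∀ w, ℕ → S w → A w → (∀ w', S w' → ℝ) → S w → ℝ)
    (r : ∀ w, ℕ → S w → A w → (∀ w', S w' → ℝ) → ℝ)
    (μ₁ : ∀ w, S w → ℝ) (πt π : ∀ w, ℕ → S w → A w → ℝ) (w : Fin W) : ℝ :=
  ∑ h ∈ Finset.range H, ∑ s, ∑ a,
    densWF P μ₁ π πt w h s * πt w h s a * r w h s a (densMT P μ₁ π h)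

/-- ℓ1 distance between two tuples of densities: `Σ_w ‖μ^w − μ'^w‖₁`. -/
def l1MT {W : ℕ} {S : Fin W → Type*} [∀ w, Fintype (S w)] (μ μ' : ∀ w, S w → ℝ) : ℝ :=
  ∑ w, ∑ s, |μ w s - μ' w s|

open Polynomial in
/-- The determinant along a line is a polynomial of degree at most the dimension, so its value
at `1` is a fixed combination of its values at any `finrank + 1` distinct nodes. -/
lemma exists_weights_det_id_add {E : Type*} [NormedAddCommGroup E] [NormedSpace ℝ E]
    [FiniteDimensional ℝ E] (v : ℕ → ℝ) (hv : Function.Injective v) :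
    ∃ c : ℕ → ℝ, ∑ i ∈ Finset.range (Module.finrank ℝ E + 1), c i = 1 ∧
      ∀ L : E →L[ℝ] E, (ContinuousLinearMap.id ℝ E + L).det =
        ∑ i ∈ Finset.range (Module.finrank ℝ E + 1),
          c i * (ContinuousLinearMap.id ℝ E + v i • L).det := by
  classical
  set s := Finset.range (Module.finrank ℝ E + 1) with hs
  have key : ∀ p : ℝ[X], p.natDegree ≤ Module.finrank ℝ E →
      p.eval 1 = ∑ i ∈ s, (Lagrange.basis s v i).eval 1 * p.eval (v i) := by
    intro p hp
    have h1 : p.degree < s.card := by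
      rw [hs, Finset.card_range]
      exact lt_of_le_of_lt degree_le_natDegree (by exact_mod_cast Nat.lt_succ_of_le hp)
    have h2 := Lagrange.eq_interpolate (s := s) (v := v) hv.injOn h1
    conv_lhs => rw [h2]
    rw [Lagrange.interpolate_apply, eval_finsetSum]
    refine Finset.sum_congr rfl fun i _ => ?_
    rw [eval_mul, eval_C, mul_comm]
  refine ⟨fun i => (Lagrange.basis s v i).eval 1, ?_, ?_⟩
  · simpa using (key 1 (by simp)).symm
  · intro L
    let b := Module.finBasis ℝ E
    let M := LinearMap.toMatrix b b (L : E →ₗ[ℝ] E)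
    let p : ℝ[X] := Matrix.det ((X : ℝ[X]) • M.map C + (1 : Matrix _ _ ℝ).map C)
    have hp : p.natDegree ≤ Module.finrank ℝ E := by
      simpa only [Fintype.card_fin] using natDegree_det_X_add_C_le M 1
    have hdet : ∀ t : ℝ, p.eval t = (ContinuousLinearMap.id ℝ E + t • L).det := by
      intro t
      rw [ContinuousLinearMap.det, ← LinearMap.det_toMatrix b]
      have : LinearMap.toMatrix b b ((ContinuousLinearMap.id ℝ E + t • L : E →L[ℝ] E) : E →ₗ[ℝ] E)
          = t • M + 1 := by
        simp only [M, ContinuousLinearMap.toLinearMap_add,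
          ContinuousLinearMap.toLinearMap_smul, map_add, map_smul]
        rw [add_comm, ContinuousLinearMap.coe_id, LinearMap.toMatrix_id]
      rw [this, ← coe_evalRingHom, RingHom.map_det]
      congr 1
      ext i j
      simp [Matrix.one_apply, apply_ite (eval t)]
      exact mul_comm _ _
    have := key p hp
    simp only [hdet, one_smul] at this
    exact this

/-- A Lipschitz perturbation of the identity with small constant, supported in the closed unit
ball, maps the ball bijectively onto itself. -/
lemma bijOn_closedBall_add_smul {E : Type*} [NormedAddCommGroup E] [NormedSpace ℝ E]
    [CompleteSpace E] {g : E → E} {K : NNReal} (hg : LipschitzWith K g)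
    (hg0 : ∀ x, 1 < ‖x‖ → g x = 0) {t : ℝ} (ht0 : 0 ≤ t) (ht : t * K < 1) :
    Set.BijOn (fun x => x + t • g x) (Metric.closedBall 0 1) (Metric.closedBall 0 1) := by
  have hinj : Function.Injective (fun x => x + t • g x) := by
    intro x y hxy
    have h1 : x - y = t • (g y - g x) := by
      have : x + t • g x = y + t • g y := hxy
      rw [smul_sub, sub_eq_sub_iff_add_eq_add, this, add_comm]
    have h2 : ‖x - y‖ ≤ t * K * ‖x - y‖ := by
      calc ‖x - y‖ = t * ‖g y - g x‖ := by rw [h1, norm_smul, Real.norm_of_nonneg ht0]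
        _ ≤ t * (K * ‖y - x‖) := by
            gcongr
            exact hg.norm_sub_le _ _
        _ = _ := by rw [norm_sub_rev y x]; ring
    have h3 : ‖x - y‖ = 0 := by
      by_contra hne
      have : 0 < ‖x - y‖ := lt_of_le_of_ne (norm_nonneg _) (Ne.symm hne)
      nlinarith
    exact sub_eq_zero.1 (norm_eq_zero.1 h3)
  have hout : ∀ x, 1 < ‖x‖ → x + t • g x = x := fun x hx => by simp [hg0 x hx]
  refine ⟨?_, hinj.injOn, ?_⟩
  · intro x hx
    simp only [mem_closedBall_zero_iff] at hx ⊢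
    by_contra! h
    have := hinj (hout _ h)
    simp only at this
    rw [this] at h
    exact absurd hx (not_le.2 h)
  · intro y hy
    have hc : ContractingWith (Real.toNNReal t * K) (fun x => y - t • g x) := by
      refine ⟨?_, ?_⟩
      · rw [← NNReal.coe_lt_coe]
        simpa [ht0] using ht
      · refine LipschitzWith.of_dist_le_mul fun a b => ?_
        have h := hg.norm_sub_le b a
        rw [dist_eq_norm, dist_eq_norm]
        have : y - t • g a - (y - t • g b) = t • (g b - g a) := by
          rw [smul_sub]; abel
        rw [this, norm_smul, Real.norm_of_nonneg ht0, NNReal.coe_mul, Real.coe_toNNReal _ ht0,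
          mul_assoc, norm_sub_rev a b]
        gcongr
    have hfix := hc.fixedPoint_isFixedPt
    set x := ContractingWith.fixedPoint _ hc
    have hx : x + t • g x = y := by
      have : y - t • g x = x := hfix
      nth_rewrite 1 [← this]; simp
    refine ⟨x, ?_, hx⟩
    simp only [mem_closedBall_zero_iff] at hy ⊢
    by_contra! h
    rw [hout x h] at hx
    rw [hx] at h
    exact absurd hy (not_le.2 h)

/-- A Lipschitz function on the closed unit ball vanishing on the unit sphere stays Lipschitz
after extension by zero. -/
lemma lipschitzWith_indicator_closedBall {E : Type*} [NormedAddCommGroup E] [NormedSpace ℝ E]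
    [Nontrivial E] {g : E → E} {K : NNReal} (hg : LipschitzOnWith K g (Metric.closedBall 0 1))
    (hg0 : ∀ x, ‖x‖ = 1 → g x = 0) :
    LipschitzWith K ((Metric.closedBall 0 1).indicator g) := by
  have hbd : ∀ x, ‖x‖ ≤ 1 → ‖g x‖ ≤ K * (1 - ‖x‖) := by
    intro x hx
    obtain ⟨z, hz, hxz⟩ : ∃ z : E, ‖z‖ = 1 ∧ ‖x - z‖ ≤ 1 - ‖x‖ := by
      by_cases h0 : x = 0
      · obtain ⟨z, hz⟩ := exists_norm_eq E (zero_le_one (α := ℝ))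
        exact ⟨z, hz, by simp [h0, hz]⟩
      · have hpos : 0 < ‖x‖ := norm_pos_iff.2 h0
        refine ⟨‖x‖⁻¹ • x, by rw [norm_smul, norm_inv, norm_norm, inv_mul_cancel₀ hpos.ne'], ?_⟩
        have : x - ‖x‖⁻¹ • x = (1 - ‖x‖⁻¹) • x := by rw [sub_smul, one_smul]
        rw [this, norm_smul, Real.norm_eq_abs, abs_of_nonpos, neg_sub, sub_mul,
          inv_mul_cancel₀ hpos.ne', one_mul]
        have := (one_le_inv₀ hpos).2 hx
        linarith
    have h := hg.norm_sub_le (mem_closedBall_zero_iff.2 hx) (mem_closedBall_zero_iff.2 hz.le)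
    rw [hg0 z hz, sub_zero] at h
    exact h.trans (by gcongr)
  refine LipschitzWith.of_dist_le_mul fun x y => ?_
  rw [dist_eq_norm, dist_eq_norm]
  have hmix : ∀ x y : E, ‖x‖ ≤ 1 → 1 < ‖y‖ → ‖g x‖ ≤ K * ‖x - y‖ := by
    intro x y hx hy
    refine (hbd x hx).trans ?_
    gcongr
    have := norm_sub_norm_le y x
    rw [norm_sub_rev]
    linarith
  by_cases hx : ‖x‖ ≤ 1 <;> by_cases hy : ‖y‖ ≤ 1
  · rw [Set.indicator_of_mem (by simpa using hx), Set.indicator_of_mem (by simpa using hy)]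
    exact hg.norm_sub_le (mem_closedBall_zero_iff.2 hx) (mem_closedBall_zero_iff.2 hy)
  · rw [Set.indicator_of_mem (by simpa using hx), Set.indicator_of_notMem (by simpa using hy),
      sub_zero]
    exact hmix x y hx (not_le.1 hy)
  · rw [Set.indicator_of_notMem (by simpa using hx), Set.indicator_of_mem (by simpa using hy),
      zero_sub, norm_neg, norm_sub_rev]
    exact hmix y x hy (not_le.1 hx)
  · rw [Set.indicator_of_notMem (by simpa using hx), Set.indicator_of_notMem (by simpa using hy)]
    simp only [sub_self, norm_zero]
    positivity

/-- A small perturbation of the identity has positive determinant. -/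
lemma det_id_add_smul_pos {E : Type*} [NormedAddCommGroup E] [NormedSpace ℝ E]
    [FiniteDimensional ℝ E] {L : E →L[ℝ] E} {C t : ℝ} (hL : ‖L‖ ≤ C) (ht0 : 0 ≤ t)
    (ht : t * C < 1) : 0 < (ContinuousLinearMap.id ℝ E + t • L).det := by
  have hcont : Continuous fun s : ℝ => (ContinuousLinearMap.id ℝ E + s • L).det :=
    ContinuousLinearMap.continuous_det.comp (by fun_prop)
  have hne : ∀ s ∈ Set.Icc 0 t, (ContinuousLinearMap.id ℝ E + s • L).det ≠ 0 := by
    intro s hs h0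
    obtain ⟨x, hx, hx0⟩ := (LinearMap.hasEigenvalue_zero_tfae
      ((ContinuousLinearMap.id ℝ E + s • L : E →L[ℝ] E) : E →ₗ[ℝ] E)).out 3 5 |>.1 h0
    have h1 : x = -(s • L x) := by
      have : x + s • L x = 0 := by simpa using hx0
      exact eq_neg_of_add_eq_zero_left this
    have h2 : ‖x‖ ≤ s * (C * ‖x‖) := by
      conv_lhs => rw [h1, norm_neg, norm_smul, Real.norm_of_nonneg hs.1]
      gcongr
      · exact hs.1
      · exact L.le_of_opNorm_le hL x
    have h3 : 0 < ‖x‖ := norm_pos_iff.2 hx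
    have hC : 0 ≤ C := (norm_nonneg _).trans hL
    have h4 : s * C ≤ t * C := by gcongr; exact hs.2
    nlinarith
  by_contra! h
  obtain ⟨s, hs, hs0⟩ := intermediate_value_Icc' ht0 hcont.continuousOn
    (show (0 : ℝ) ∈ Set.Icc _ _ from ⟨h, by simp [ContinuousLinearMap.det]⟩)
  exact hne s hs hs0

open MeasureTheory in
/-- There is no `C¹` retraction of the closed unit ball onto the unit sphere. -/
lemma not_exists_smooth_retraction {E : Type*} [NormedAddCommGroup E] [InnerProductSpace ℝ E]
    [FiniteDimensional ℝ E] [Nontrivial E] (r : E → E)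
    (hr : ∀ x, ‖x‖ ≤ 1 → ContDiffAt ℝ 1 r x) (hs : ∀ x, ‖x‖ = 1 → r x = x)
    (hm : ∀ x, ‖x‖ ≤ 1 → ‖r x‖ = 1) : False := by
  borelize E
  set B : Set E := Metric.closedBall 0 1 with hB
  have hBmem : ∀ x, x ∈ B ↔ ‖x‖ ≤ 1 := fun x => mem_closedBall_zero_iff
  set g : E → E := fun x => r x - x with hg
  have hgc : ∀ x, ‖x‖ ≤ 1 → ContDiffAt ℝ 1 g x := fun x hx => (hr x hx).sub contDiffAt_id
  have hgd : ∀ x ∈ B, DifferentiableAt ℝ g x := fun x hx =>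
    (hgc x ((hBmem x).1 hx)).differentiableAt one_ne_zero
  have hg'c : ContinuousOn (fderiv ℝ g) B := fun x hx =>
    ((hgc x ((hBmem x).1 hx)).continuousAt_fderiv one_ne_zero).continuousWithinAt
  have hBc : IsCompact B := isCompact_closedBall 0 1
  obtain ⟨C, hC⟩ := hBc.exists_bound_of_continuousOn hg'c
  set K : NNReal := C.toNNReal with hK
  have hgK : ∀ x ∈ B, ‖fderiv ℝ g x‖ ≤ K := fun x hx => (hC x hx).trans (Real.le_coe_toNNReal C)
  have hlip : LipschitzOnWith K g B :=
    (convex_closedBall 0 1).lipschitzOnWith_of_nnnorm_fderiv_le hgd fun x hx => hgK x hx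
  have hext : LipschitzWith K (B.indicator g) :=
    lipschitzWith_indicator_closedBall hlip fun x hx => by simp [hg, hs x hx]
  set v : ℕ → ℝ := fun i => 1 / ((K + 1) * (i + 1)) with hv
  have hvpos : ∀ i, 0 < v i := fun i => by positivity
  have hvK : ∀ i, v i * K < 1 := by
    intro i
    have hi : (0 : ℝ) ≤ i := by positivity
    have hK0 : (0 : ℝ) ≤ K := K.2
    rw [hv]
    simp only
    rw [one_div_mul_eq_div, div_lt_one (by positivity)]
    nlinarith
  have hvinj : Function.Injective v := by
    intro i j hij
    have hK0 : ((K : ℝ) + 1) ≠ 0 := by positivity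
    simp only [hv, one_div, inv_inj, mul_right_inj' hK0, add_left_inj, Nat.cast_inj] at hij
    exact hij
  have hvol : ∀ i, ∫ x in B, (ContinuousLinearMap.id ℝ E + v i • fderiv ℝ g x).det =
      (volume B).toReal := by
    intro i
    have hbij : Set.BijOn (fun x => x + v i • g x) B B := by
      have h := bijOn_closedBall_add_smul hext (fun x hx => Set.indicator_of_notMem
        (fun hxB => absurd ((hBmem x).1 hxB) (not_le.2 hx)) _) (hvpos i).le (hvK i)
      exact h.congr fun x hx => by simp [Set.indicator_of_mem (show x ∈ B from hx)]
    have h := integral_image_eq_integral_abs_det_fderiv_smul (volume : Measure E)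
      (f := fun x => x + v i • g x)
      (f' := fun x => ContinuousLinearMap.id ℝ E + v i • fderiv ℝ g x)
      (measurableSet_closedBall : MeasurableSet B)
      (fun x hx => ((hasFDerivAt_id x).add ((hgd x hx).hasFDerivAt.const_smul (v i))
        ).hasFDerivWithinAt) hbij.injOn (fun _ => (1 : ℝ))
    rw [hbij.image_eq] at h
    simp only [smul_eq_mul, mul_one, integral_const, measureReal_restrict_apply_univ] at h
    rw [show (volume B).toReal = volume.real B from rfl, h]
    refine setIntegral_congr_fun measurableSet_closedBall fun x hx => ?_
    exact (abs_of_pos (det_id_add_smul_pos (hgK x hx) (hvpos i).le (hvK i))).symm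
  have hdetc : ∀ t : ℝ, ContinuousOn
      (fun x => (ContinuousLinearMap.id ℝ E + t • fderiv ℝ g x).det) B := fun t =>
    ContinuousLinearMap.continuous_det.comp_continuousOn
      (continuousOn_const.add (hg'c.const_smul t))
  have hzero : ∀ x ∈ B, (ContinuousLinearMap.id ℝ E + fderiv ℝ g x).det = 0 := by
    have hcl : B ⊆ closure (Metric.ball 0 1) := (closure_ball (0 : E) one_ne_zero).ge
    have hc1 := hdetc 1
    simp only [one_smul] at hc1
    refine Set.EqOn.of_subset_closure (s := Metric.ball (0 : E) 1) ?_ hc1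
      (continuousOn_const (c := (0 : ℝ))) Metric.ball_subset_closedBall hcl
    intro x hx
    have hx1 : ‖x‖ < 1 := mem_ball_zero_iff.1 hx
    have hrd : HasFDerivAt r (ContinuousLinearMap.id ℝ E + fderiv ℝ g x) x := by
      have := (hasFDerivAt_id x).add (hgd x ((hBmem x).2 hx1.le)).hasFDerivAt
      refine this.congr_of_eventuallyEq (Filter.Eventually.of_forall fun y => ?_)
      simp [hg]
    have hconst : HasFDerivAt (fun y => ‖r y‖ ^ 2) (0 : E →L[ℝ] ℝ) x := by
      refine (hasFDerivAt_const (1 : ℝ) x).congr_of_eventuallyEq ?_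
      filter_upwards [Metric.isOpen_ball.mem_nhds hx] with y hy
      simp [hm y (mem_ball_zero_iff.1 hy).le]
    have horth := hrd.norm_sq.unique hconst
    by_contra hne
    have hu : IsUnit ((ContinuousLinearMap.id ℝ E + fderiv ℝ g x : E →L[ℝ] E) : E →ₗ[ℝ] E) :=
      (LinearMap.isUnit_iff_isUnit_det _).2 (isUnit_iff_ne_zero.2 hne)
    obtain ⟨w, hw⟩ := ((Module.End.isUnit_iff _).1 hu).2 (r x)
    have hw' : (ContinuousLinearMap.id ℝ E + fderiv ℝ g x) w = r x := hw
    have h0 := DFunLike.congr_fun horth w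
    rw [smul_apply, ContinuousLinearMap.comp_apply, hw', innerSL_apply_apply,
      real_inner_self_eq_norm_sq, hm x hx1.le] at h0
    norm_num at h0
  obtain ⟨c, hc1, hc⟩ := exists_weights_det_id_add (E := E) v hvinj
  have hint : ∫ x in B, (ContinuousLinearMap.id ℝ E + fderiv ℝ g x).det =
      (volume B).toReal := by
    rw [integral_congr_ae (Filter.Eventually.of_forall fun x => hc (fderiv ℝ g x)),
      integral_finsetSum _ fun i _ =>
      ((hdetc (v i)).integrableOn_compact hBc).const_mul (c i)]
    simp only [integral_const_mul, hvol]
    rw [← Finset.sum_mul, hc1, one_mul]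
  rw [setIntegral_congr_fun measurableSet_closedBall hzero] at hint
  simp only [integral_zero] at hint
  have hpos : 0 < (volume B).toReal := ENNReal.toReal_pos
    (Metric.measure_closedBall_pos volume 0 one_pos).ne' hBc.measure_lt_top.ne
  exact hpos.ne hint

/-- Brouwer's theorem for `C¹` self-maps of the closed unit ball. -/
lemma exists_fixedPoint_of_contDiff {E : Type*} [NormedAddCommGroup E] [InnerProductSpace ℝ E]
    [FiniteDimensional ℝ E] [Nontrivial E] {f : E → E} (hf : ContDiff ℝ 1 f)
    (hfb : ∀ x, ‖f x‖ ≤ 1) : ∃ x, ‖x‖ ≤ 1 ∧ f x = x := by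
  by_contra! hne
  set u : E → E := fun x => x - f x with hu
  have huc : ContDiff ℝ 1 u := contDiff_id.sub hf
  have hu0 : ∀ x, ‖x‖ ≤ 1 → 0 < ‖u x‖ ^ 2 := fun x hx =>
    pow_pos (norm_pos_iff.2 (sub_ne_zero.2 (hne x hx).symm)) 2
  have hsph : ∀ x, ‖x‖ = 1 → 0 < inner ℝ x (u x) := by
    intro x hx
    have h1 : inner ℝ x (f x) < 1 := by
      have h2 : ‖x - f x‖ ^ 2 = ‖x‖ ^ 2 - 2 * inner ℝ x (f x) + ‖f x‖ ^ 2 := norm_sub_sq_real _ _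
      have h3 := hu0 x hx.le
      have h4 := hfb x
      have h5 := norm_nonneg (f x)
      simp only [hu] at h3
      rw [h2, hx] at h3
      nlinarith
    simp only [hu]
    rw [inner_sub_right, real_inner_self_eq_norm_sq, hx]
    linarith
  set D : E → ℝ := fun x => inner ℝ x (u x) ^ 2 + ‖u x‖ ^ 2 * (1 - ‖x‖ ^ 2) with hD
  have hD0 : ∀ x, ‖x‖ ≤ 1 → 0 < D x := by
    intro x hx
    rcases hx.lt_or_eq with h | h
    · have : 0 < 1 - ‖x‖ ^ 2 := by nlinarith [norm_nonneg x]
      have := mul_pos (hu0 x hx) this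
      have := sq_nonneg (inner ℝ x (u x))
      simp only [hD]
      linarith
    · have := pow_pos (hsph x h) 2
      simp only [hD, h]
      linarith
  have hDc : ContDiff ℝ 1 D :=
    ((contDiff_id.inner ℝ huc).pow 2).add
      ((huc.norm_sq ℝ).mul (contDiff_const.sub (contDiff_id.norm_sq ℝ)))
  set s : E → ℝ := fun x => (√(D x) - inner ℝ x (u x)) / ‖u x‖ ^ 2 with hs
  have hsc : ∀ x, ‖x‖ ≤ 1 → ContDiffAt ℝ 1 s x := fun x hx =>
    ((hDc.contDiffAt.sqrt (hD0 x hx).ne').sub (contDiff_id.inner ℝ huc).contDiffAt).div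
      (huc.norm_sq ℝ).contDiffAt (hu0 x hx).ne'
  refine not_exists_smooth_retraction (fun x => x + s x • u x)
    (fun x hx => contDiffAt_id.add ((hsc x hx).smul huc.contDiffAt)) ?_ ?_
  · intro x hx
    have : s x = 0 := by
      simp only [hs, hD, hx]
      rw [one_pow, sub_self, mul_zero, add_zero, Real.sqrt_sq (hsph x hx).le, sub_self, zero_div]
    simp [this]
  · intro x hx
    have h1 : ‖x + s x • u x‖ ^ 2 = 1 := by
      rw [norm_add_sq_real, norm_smul, inner_smul_right, mul_pow, Real.norm_eq_abs, sq_abs]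
      have h2 := Real.sq_sqrt (hD0 x hx).le
      have h3 := (hu0 x hx).ne'
      have h4 : s x * ‖u x‖ ^ 2 = √(D x) - inner ℝ x (u x) :=
        div_mul_cancel₀ _ h3
      have h5 : (‖x‖ ^ 2 + 2 * (s x * inner ℝ x (u x)) + s x ^ 2 * ‖u x‖ ^ 2 - 1) * ‖u x‖ ^ 2
          = 0 := by
        have : (‖x‖ ^ 2 + 2 * (s x * inner ℝ x (u x)) + s x ^ 2 * ‖u x‖ ^ 2 - 1) * ‖u x‖ ^ 2 =
            (s x * ‖u x‖ ^ 2) ^ 2 + 2 * (s x * ‖u x‖ ^ 2) * inner ℝ x (u x)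
              - ‖u x‖ ^ 2 * (1 - ‖x‖ ^ 2) := by ring
        rw [this, h4]
        have h6 : √(D x) ^ 2 = inner ℝ x (u x) ^ 2 + ‖u x‖ ^ 2 * (1 - ‖x‖ ^ 2) := h2
        linear_combination h6
      rcases mul_eq_zero.1 h5 with h | h
      · linarith
      · exact absurd h h3
    exact (pow_eq_one_iff_of_nonneg (norm_nonneg _) two_ne_zero).1 h1

/-- **Brouwer's fixed point theorem**: a bounded continuous self-map of a finite-dimensional
inner product space has a fixed point. -/
theorem exists_fixedPoint_of_continuous_of_bounded {E : Type*} [NormedAddCommGroup E]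
    [InnerProductSpace ℝ E] [FiniteDimensional ℝ E] {f : E → E} (hf : Continuous f) {R : ℝ}
    (hfR : ∀ x, ‖f x‖ ≤ R) : ∃ x, f x = x := by
  rcases subsingleton_or_nontrivial E with hE | hE
  · exact ⟨0, Subsingleton.elim _ _⟩
  by_contra! hne
  obtain ⟨ρ, hρ0, hρ⟩ : ∃ ρ : ℝ, 0 < ρ ∧ ∀ x, ‖f x‖ ≤ ρ :=
    ⟨max R 1, by positivity, fun x => (hfR x).trans (le_max_left _ _)⟩
  obtain ⟨x₀, -, hx₀⟩ := (isCompact_closedBall (0 : E) (ρ + 1)).exists_isMinOn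
    ⟨0, by simpa using by positivity⟩ (f := fun x => ‖f x - x‖) (by fun_prop)
  set δ : ℝ := min (‖f x₀ - x₀‖) 1 with hδ
  have hδ0 : 0 < δ := lt_min (norm_pos_iff.2 (sub_ne_zero.2 (hne x₀))) one_pos
  obtain ⟨g, hgc, hgf, -⟩ := hf.exists_contDiff_approx 1 (ε := fun _ => δ) continuous_const
    fun _ => hδ0
  have hgf' : ∀ x, ‖g x - f x‖ < δ := fun x => by rw [← dist_eq_norm]; exact hgf x
  have hg : ∀ x, ‖g x‖ ≤ ρ + 1 := fun x => by
    have h1 := norm_le_norm_add_norm_sub' (g x) (f x)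
    have h2 := hgf' x
    have h3 : δ ≤ 1 := min_le_right _ _
    linarith [hρ x]
  have hρ1 : 0 < ρ + 1 := by positivity
  obtain ⟨y, hy, hfix⟩ := exists_fixedPoint_of_contDiff
    (f := fun x => (ρ + 1)⁻¹ • g ((ρ + 1) • x))
    ((hgc.comp (contDiff_id.const_smul (ρ + 1))).const_smul (ρ + 1)⁻¹) (fun x => by
      rw [norm_smul, norm_inv, Real.norm_of_nonneg hρ1.le, inv_mul_le_iff₀ hρ1, mul_one]
      exact hg _)
  have hfix' : g ((ρ + 1) • y) = (ρ + 1) • y := by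
    rwa [inv_smul_eq_iff₀ hρ1.ne'] at hfix
  have h1 := hgf' ((ρ + 1) • y)
  rw [hfix', norm_sub_rev] at h1
  have h2 : ‖f x₀ - x₀‖ ≤ ‖f ((ρ + 1) • y) - (ρ + 1) • y‖ := hx₀ (by
    rw [mem_closedBall_zero_iff, norm_smul, Real.norm_of_nonneg hρ1.le]
    nlinarith)
  exact absurd (h2.trans_lt h1) (not_lt.2 (min_le_left _ _))

/-- The improvement map of Nash: shift the distribution `p` towards the actions whose value `q`
exceeds the mean value. -/
noncomputable def nashUpdate {A : Type*} [Fintype A] (p q : A → ℝ) (a : A) : ℝ :=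
  (p a + max 0 (q a - ∑ b, p b * q b)) / (1 + ∑ b, max 0 (q b - ∑ c, p c * q c))

lemma nashUpdate_nonneg {A : Type*} [Fintype A] {p : A → ℝ} (hp : ∀ a, 0 ≤ p a) (q : A → ℝ)
    (a : A) : 0 ≤ nashUpdate p q a := by
  have := hp a
  have := Finset.sum_nonneg fun (b : A) (_ : b ∈ Finset.univ) =>
    le_max_left 0 (q b - ∑ c, p c * q c)
  unfold nashUpdate
  positivity

lemma sum_nashUpdate {A : Type*} [Fintype A] {p : A → ℝ} (hp : ∑ a, p a = 1) (q : A → ℝ) :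
    ∑ a, nashUpdate p q a = 1 := by
  have := Finset.sum_nonneg fun (b : A) (_ : b ∈ Finset.univ) =>
    le_max_left 0 (q b - ∑ c, p c * q c)
  unfold nashUpdate
  rw [← Finset.sum_div, Finset.sum_add_distrib, hp]
  exact div_self (by positivity)

lemma le_sum_of_nashUpdate_eq {A : Type*} [Fintype A] {p q : A → ℝ} (hp : ∑ a, p a = 1)
    (h : ∀ a, nashUpdate p q a = p a) (a : A) : q a ≤ ∑ b, p b * q b := by
  set v := ∑ b, p b * q b with hv
  set T := ∑ b, max 0 (q b - v) with hT
  have hT0 : 0 ≤ T := Finset.sum_nonneg fun b _ => le_max_left _ _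
  have he : ∀ b, max 0 (q b - v) = T * p b := by
    intro b
    have := h b
    unfold nashUpdate at this
    rw [← hv, ← hT, div_eq_iff (by positivity)] at this
    linarith
  have hsum : ∑ b, max 0 (q b - v) ^ 2 = 0 := by
    calc ∑ b, max 0 (q b - v) ^ 2 = ∑ b, T * p b * (q b - v) := by
          refine Finset.sum_congr rfl fun b _ => ?_
          rw [← he b]
          rcases le_total (q b - v) 0 with h0 | h0
          · simp [max_eq_left h0]
          · rw [max_eq_right h0, sq]
      _ = T * (∑ b, p b * q b - (∑ b, p b) * v) := by
          rw [Finset.sum_mul Finset.univ p, ← Finset.sum_sub_distrib, Finset.mul_sum Finset.univ]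
          exact Finset.sum_congr rfl fun b _ => by ring
      _ = 0 := by rw [hp, ← hv]; ring
  have h0 := (Finset.sum_eq_zero_iff_of_nonneg fun b _ => sq_nonneg _).1 hsum a (Finset.mem_univ a)
  have h1 := le_max_right 0 (q a - v)
  rw [pow_eq_zero_iff two_ne_zero] at h0
  linarith

/-- A continuous retraction of `A → ℝ` onto the standard simplex. -/
noncomputable def simplexRetraction {A : Type*} [Fintype A] (y : A → ℝ) (a : A) : ℝ :=
  (max (y a) 0 + max 0 (1 - ∑ b, max (y b) 0) / Fintype.card A) / max 1 (∑ b, max (y b) 0)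

lemma simplexRetraction_nonneg {A : Type*} [Fintype A] (y : A → ℝ) (a : A) :
    0 ≤ simplexRetraction y a := by
  unfold simplexRetraction
  positivity

lemma sum_simplexRetraction {A : Type*} [Fintype A] [Nonempty A] (y : A → ℝ) :
    ∑ a, simplexRetraction y a = 1 := by
  unfold simplexRetraction
  set T := ∑ b, max (y b) 0 with hT
  have hc : (Fintype.card A : ℝ) ≠ 0 := by exact_mod_cast Fintype.card_ne_zero
  rw [← Finset.sum_div, Finset.sum_add_distrib, ← hT, Finset.sum_const, Finset.card_univ,
    nsmul_eq_mul, mul_div_cancel₀ _ hc]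
  rcases le_total T 1 with h | h
  · rw [max_eq_right (by linarith), max_eq_left h]; ring
  · rw [max_eq_left (by linarith), max_eq_right h, add_zero, div_self (by positivity)]

lemma simplexRetraction_eq_self {A : Type*} [Fintype A] {y : A → ℝ} (h0 : ∀ a, 0 ≤ y a)
    (h1 : ∑ a, y a = 1) : simplexRetraction y = y := by
  ext a
  simp [simplexRetraction, h0, h1]

lemma continuous_simplexRetraction {X A : Type*} [TopologicalSpace X] [Fintype A]
    {y : X → A → ℝ} (hy : ∀ a, Continuous fun x => y x a) (a : A) :
    Continuous fun x => simplexRetraction (y x) a := by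
  unfold simplexRetraction
  have hT : Continuous fun x => ∑ b, max (y x b) 0 :=
    continuous_finsetSum _ fun b _ => (hy b).max continuous_const
  refine Continuous.div ?_ (continuous_const.max hT) fun x => by positivity
  exact ((hy a).max continuous_const).add
    ((continuous_const.max (continuous_const.sub hT)).div_const _)

lemma continuous_nashUpdate {X A : Type*} [TopologicalSpace X] [Fintype A] {p q : X → A → ℝ}
    (hp : ∀ a, Continuous fun x => p x a) (hq : ∀ a, Continuous fun x => q x a) (a : A) :
    Continuous fun x => nashUpdate (p x) (q x) a := by
  unfold nashUpdate
  have hv : Continuous fun x => ∑ b, p x b * q x b :=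
    continuous_finsetSum _ fun b _ => (hp b).mul (hq b)
  have he : ∀ b, Continuous fun x => max 0 (q x b - ∑ c, p x c * q x c) :=
    fun b => continuous_const.max ((hq b).sub hv)
  refine ((hp a).add (he a)).div (continuous_const.add (continuous_finsetSum _ fun b _ => he b))
    fun x => ?_
  have := Finset.sum_nonneg fun (b : A) (_ : b ∈ Finset.univ) =>
    le_max_left 0 (q x b - ∑ c, p x c * q x c)
  positivity

/-- Expected reward over `n` steps from state `s` at time `h` in a finite-horizon decision process
with kernels `p`, rewards `c` and policy `π`. -/
def valueToGo {S A : Type*} [Fintype S] [Fintype A] (p : ℕ → S → A → S → ℝ)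
    (c : ℕ → S → A → ℝ) (π : ℕ → S → A → ℝ) : ℕ → ℕ → S → ℝ
  | 0, _, _ => 0
  | n + 1, h, s => ∑ a, π h s a * (c h s a + ∑ s', p h s a s' * valueToGo p c π n (h + 1) s')

/-- Value of playing `a` in state `s` at time `h` and following `π` for `n` further steps. -/
def actionValue {S A : Type*} [Fintype S] [Fintype A] (p : ℕ → S → A → S → ℝ)
    (c : ℕ → S → A → ℝ) (π : ℕ → S → A → ℝ) (n h : ℕ) (s : S) (a : A) : ℝ :=
  c h s a + ∑ s', p h s a s' * valueToGo p c π n (h + 1) s'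

lemma valueToGo_succ {S A : Type*} [Fintype S] [Fintype A] (p : ℕ → S → A → S → ℝ)
    (c : ℕ → S → A → ℝ) (π : ℕ → S → A → ℝ) (n h : ℕ) (s : S) :
    valueToGo p c π (n + 1) h s = ∑ a, π h s a * actionValue p c π n h s a := rfl

lemma sum_reward_add_sum_value {S A : Type*} [Fintype S] [Fintype A] {p : S → A → S → ℝ}
    {c : S → A → ℝ} {π : S → A → ℝ} {d d' : S → ℝ} (v : S → ℝ)
    (hd : ∀ s', d' s' = ∑ s, ∑ a, d s * π s a * p s a s') :
    ∑ s, ∑ a, d s * π s a * c s a + ∑ s', d' s' * v s' =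
      ∑ s, d s * ∑ a, π s a * (c s a + ∑ s', p s a s' * v s') := by
  have h1 : ∑ s', d' s' * v s' = ∑ s, ∑ a, d s * π s a * ∑ s', p s a s' * v s' := by
    simp only [hd, Finset.sum_mul]
    rw [Finset.sum_comm]
    refine Finset.sum_congr rfl fun s _ => ?_
    rw [Finset.sum_comm]
    refine Finset.sum_congr rfl fun a _ => ?_
    rw [Finset.mul_sum]
    exact Finset.sum_congr rfl fun s' _ => by ring
  rw [h1, ← Finset.sum_add_distrib]
  refine Finset.sum_congr rfl fun s _ => ?_
  rw [← Finset.sum_add_distrib, Finset.mul_sum]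
  exact Finset.sum_congr rfl fun a _ => by ring

/-- The total reward of a policy along its own state law is its initial expected value. -/
lemma sum_reward_eq_sum_valueToGo {S A : Type*} [Fintype S] [Fintype A]
    {p : ℕ → S → A → S → ℝ} {c : ℕ → S → A → ℝ} {π : ℕ → S → A → ℝ} {d : ℕ → S → ℝ} (H : ℕ)
    (hd : ∀ h s', d (h + 1) s' = ∑ s, ∑ a, d h s * π h s a * p h s a s') :
    ∑ h ∈ Finset.range H, ∑ s, ∑ a, d h s * π h s a * c h s a =
      ∑ s, d 0 s * valueToGo p c π H 0 s := by
  have key : ∀ k ≤ H, ∑ h ∈ Finset.range k, ∑ s, ∑ a, d h s * π h s a * c h s a +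
      ∑ s, d k s * valueToGo p c π (H - k) k s = ∑ s, d 0 s * valueToGo p c π H 0 s := by
    intro k
    induction k with
    | zero => intro _; simp
    | succ k ih =>
      intro hk
      rw [← ih (by lia), Finset.sum_range_succ, add_assoc, sum_reward_add_sum_value _ (hd k),
        show H - k = H - (k + 1) + 1 by lia]
      rfl
  simpa [valueToGo] using key H le_rfl

/-- If no one-step deviation improves on `π`, then no policy improves on the initial expected value
of `π`. -/
lemma sum_reward_le_sum_valueToGo {S A : Type*} [Fintype S] [Fintype A]
    {p : ℕ → S → A → S → ℝ} {c : ℕ → S → A → ℝ} {π πt : ℕ → S → A → ℝ} {d : ℕ → S → ℝ} {H : ℕ}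
    (hd : ∀ h s', d (h + 1) s' = ∑ s, ∑ a, d h s * πt h s a * p h s a s')
    (hd0 : ∀ h < H, ∀ s, 0 ≤ d h s) (hπt0 : ∀ h s a, 0 ≤ πt h s a)
    (hπt1 : ∀ h s, ∑ a, πt h s a = 1)
    (hopt : ∀ h < H, ∀ s a,
      actionValue p c π (H - (h + 1)) h s a ≤ valueToGo p c π (H - h) h s) :
    ∑ h ∈ Finset.range H, ∑ s, ∑ a, d h s * πt h s a * c h s a ≤
      ∑ s, d 0 s * valueToGo p c π H 0 s := by
  have key : ∀ k ≤ H, ∑ h ∈ Finset.range k, ∑ s, ∑ a, d h s * πt h s a * c h s a +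
      ∑ s, d k s * valueToGo p c π (H - k) k s ≤ ∑ s, d 0 s * valueToGo p c π H 0 s := by
    intro k
    induction k with
    | zero => intro _; simp
    | succ k ih =>
      intro hk
      refine le_trans ?_ (ih (by lia))
      rw [Finset.sum_range_succ, add_assoc, sum_reward_add_sum_value _ (hd k)]
      gcongr with s
      · exact hd0 k hk s
      · calc _ ≤ ∑ a, πt k s a * valueToGo p c π (H - k) k s := by
              gcongr with a
              · exact hπt0 k s a
              · exact hopt k hk s a
          _ = _ := by rw [← Finset.sum_mul, hπt1, one_mul]
  simpa [valueToGo] using key H le_rfl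

lemma continuous_valueToGo {X S A : Type*} [TopologicalSpace X] [Fintype S] [Fintype A]
    {p : X → ℕ → S → A → S → ℝ} {c : X → ℕ → S → A → ℝ} {π : X → ℕ → S → A → ℝ} {H : ℕ}
    (hp : ∀ h < H, ∀ s a s', Continuous fun x => p x h s a s')
    (hc : ∀ h < H, ∀ s a, Continuous fun x => c x h s a)
    (hπ : ∀ h s a, Continuous fun x => π x h s a) (n h : ℕ) (hn : n + h ≤ H) (s : S) :
    Continuous fun x => valueToGo (p x) (c x) (π x) n h s := by
  induction n generalizing h s with
  | zero => exact continuous_const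
  | succ n ih =>
    simp only [valueToGo]
    refine continuous_finsetSum _ fun a _ => (hπ h s a).mul ((hc h (by lia) s a).add ?_)
    exact continuous_finsetSum _ fun s' _ =>
      (hp h (by lia) s a s').mul (ih (h + 1) (by lia) s')

lemma continuous_actionValue {X S A : Type*} [TopologicalSpace X] [Fintype S] [Fintype A]
    {p : X → ℕ → S → A → S → ℝ} {c : X → ℕ → S → A → ℝ} {π : X → ℕ → S → A → ℝ} {H : ℕ}
    (hp : ∀ h < H, ∀ s a s', Continuous fun x => p x h s a s')
    (hc : ∀ h < H, ∀ s a, Continuous fun x => c x h s a)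
    (hπ : ∀ h s a, Continuous fun x => π x h s a) (n h : ℕ) (hn : n + (h + 1) ≤ H)
    (s : S) (a : A) :
    Continuous fun x => actionValue (p x) (c x) (π x) n h s a :=
  (hc h (by lia) s a).add <| continuous_finsetSum _ fun s' _ =>
    (hp h (by lia) s a s').mul (continuous_valueToGo hp hc hπ n (h + 1) hn s')

/-- Pushing a distribution through a policy and a kernel gives a distribution. -/
lemma sum_mul_policy_mul_kernel_mem_stdSimplex {S A : Type*} [Fintype S] [Fintype A]
    {p : S → A → S → ℝ} {π : S → A → ℝ} {d : S → ℝ} (hd : d ∈ stdSimplex ℝ S)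
    (hπ0 : ∀ s a, 0 ≤ π s a) (hπ1 : ∀ s, ∑ a, π s a = 1)
    (hp : ∀ s a, p s a ∈ stdSimplex ℝ S) :
    (fun s' => ∑ s, ∑ a, d s * π s a * p s a s') ∈ stdSimplex ℝ S := by
  refine ⟨fun s' => Finset.sum_nonneg fun s _ => Finset.sum_nonneg fun a _ =>
    mul_nonneg (mul_nonneg (hd.1 s) (hπ0 s a)) ((hp s a).1 s'), ?_⟩
  have h := sum_reward_add_sum_value (p := p) (c := fun _ _ => 0) (π := π) (d := d)
    (fun _ => 1) (fun _ => rfl)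
  simpa [(hp _ _).2, hπ1, hd.2] using h

lemma densMT_mem_stdSimplex {W : ℕ} {S A : Fin W → Type*} [∀ w, Fintype (S w)]
    [∀ w, Fintype (A w)] {H : ℕ} {P : ∀ w, ℕ → S w → A w → (∀ w', S w' → ℝ) → S w → ℝ}
    {μ₁ : ∀ w, S w → ℝ} (hμ₁ : ∀ w, μ₁ w ∈ stdSimplex ℝ (S w)) (hP : IsKernelMT H P)
    {π : ∀ w, ℕ → S w → A w → ℝ} (hπ : IsPolicyMT π) (h : ℕ) (hh : h ≤ H) (w : Fin W) :
    densMT P μ₁ π h w ∈ stdSimplex ℝ (S w) := by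
  induction h generalizing w with
  | zero => exact hμ₁ w
  | succ h ih =>
    exact sum_mul_policy_mul_kernel_mem_stdSimplex (ih (by lia) w) (fun s => (hπ w h s).1)
      (fun s => (hπ w h s).2) fun s a => hP w h hh s a _ fun w' => ih (by lia) w'

lemma densWF_mem_stdSimplex {W : ℕ} {S A : Fin W → Type*} [∀ w, Fintype (S w)]
    [∀ w, Fintype (A w)] {H : ℕ} {P : ∀ w, ℕ → S w → A w → (∀ w', S w' → ℝ) → S w → ℝ}
    {μ₁ : ∀ w, S w → ℝ} (hμ₁ : ∀ w, μ₁ w ∈ stdSimplex ℝ (S w)) (hP : IsKernelMT H P)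
    {π πt : ∀ w, ℕ → S w → A w → ℝ} (hπ : IsPolicyMT π) (hπt : IsPolicyMT πt) (w : Fin W)
    (h : ℕ) (hh : h ≤ H) : densWF P μ₁ π πt w h ∈ stdSimplex ℝ (S w) := by
  induction h with
  | zero => exact hμ₁ w
  | succ h ih =>
    exact sum_mul_policy_mul_kernel_mem_stdSimplex (ih (by lia)) (fun s => (hπt w h s).1)
      (fun s => (hπt w h s).2) fun s a => hP w h hh s a _
        fun w' => densMT_mem_stdSimplex hμ₁ hP hπ h (by lia) w'

/-- A function controlled by the ℓ1 distance of continuously varying densities is continuous. -/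
lemma continuous_of_abs_sub_le_l1MT {X : Type*} [TopologicalSpace X] {W : ℕ} {S : Fin W → Type*}
    [∀ w, Fintype (S w)] {μ : X → ∀ w, S w → ℝ} (hμ : ∀ w s, Continuous fun x => μ x w s)
    {F : X → ℝ} (C : ℝ) (hF : ∀ x y, |F x - F y| ≤ C * l1MT (μ x) (μ y)) : Continuous F := by
  refine continuous_iff_continuousAt.2 fun y => ?_
  rw [ContinuousAt, tendsto_iff_dist_tendsto_zero]
  have hc : Continuous fun x => C * l1MT (μ x) (μ y) :=
    continuous_const.mul <| continuous_finsetSum _ fun w _ => continuous_finsetSum _ fun s _ =>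
      ((hμ w s).sub continuous_const).abs
  have h0 := hc.tendsto y
  have hz : C * l1MT (μ y) (μ y) = 0 := by simp [l1MT]
  rw [hz] at h0
  exact squeeze_zero (fun x => dist_nonneg) (fun x => (Real.dist_eq _ _).trans_le (hF x y)) h0

lemma continuous_densMT {X : Type*} [TopologicalSpace X] {W : ℕ} {S A : Fin W → Type*}
    [∀ w, Fintype (S w)] [∀ w, Fintype (A w)] {H : ℕ}
    {P : ∀ w, ℕ → S w → A w → (∀ w', S w' → ℝ) → S w → ℝ} {μ₁ : ∀ w, S w → ℝ} (C : ℝ)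
    {π : X → ∀ w, ℕ → S w → A w → ℝ} (hπ : ∀ w h s a, Continuous fun x => π x w h s a)
    (hPlip : ∀ x y w h, h < H → ∀ s a s',
      |P w h s a (densMT P μ₁ (π x) h) s' - P w h s a (densMT P μ₁ (π y) h) s'| ≤
        C * l1MT (densMT P μ₁ (π x) h) (densMT P μ₁ (π y) h))
    (h : ℕ) (hh : h ≤ H) (w : Fin W) (s : S w) :
    Continuous fun x => densMT P μ₁ (π x) h w s := by
  induction h generalizing w s with
  | zero => exact continuous_const
  | succ h ih =>
    refine continuous_finsetSum _ fun s₀ _ => continuous_finsetSum _ fun a _ =>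
      ((ih (by lia) w s₀).mul (hπ w h s₀ a)).mul ?_
    exact continuous_of_abs_sub_le_l1MT (fun w' s' => ih (by lia) w' s') C
      fun x y => hPlip x y w h hh s₀ a s

/-- The policy encoded by a vector, with uniform play outside the horizon. -/
noncomputable def policyOfVec {W : ℕ} {S A : Fin W → Type*} [∀ w, Fintype (A w)] {H : ℕ}
    (x : EuclideanSpace ℝ (Σ w, Fin H × S w × A w)) (w : Fin W) (h : ℕ) (s : S w) : A w → ℝ :=
  simplexRetraction fun b => if hh : h < H then x ⟨w, ⟨h, hh⟩, s, b⟩ else 0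

lemma isPolicyMT_policyOfVec {W : ℕ} {S A : Fin W → Type*} [∀ w, Fintype (A w)]
    [∀ w, Nonempty (A w)] {H : ℕ} (x : EuclideanSpace ℝ (Σ w, Fin H × S w × A w)) :
    IsPolicyMT (policyOfVec x) :=
  fun _ _ _ => ⟨simplexRetraction_nonneg _, sum_simplexRetraction _⟩

lemma continuous_policyOfVec {W : ℕ} {S A : Fin W → Type*} [∀ w, Fintype (A w)] {H : ℕ}
    (w : Fin W) (h : ℕ) (s : S w) (a : A w) :
    Continuous fun x : EuclideanSpace ℝ (Σ w, Fin H × S w × A w) => policyOfVec x w h s a := by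
  refine continuous_simplexRetraction (fun b => ?_) a
  split_ifs
  · fun_prop
  · exact continuous_const

/-- **Existence of Nash equilibrium in multi-type MFGs.** If a multi-type
mean-field MDP with `W` types satisfies the Lipschitz continuity assumption (transitions
with constant `L_T/W`, rewards with constant `L_r/W`, at induced densities), then it has at
least one Nash equilibrium. -/
theorem mt_mfg_NE_exists {W : ℕ} (hW : 0 < W) {S A : Fin W → Type*}
    [∀ w, Fintype (S w)] [∀ w, Fintype (A w)] [∀ w, Nonempty (A w)] (H : ℕ)
    (P : ∀ w, ℕ → S w → A w → (∀ w', S w' → ℝ) → S w → ℝ)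
    (r : ∀ w, ℕ → S w → A w → (∀ w', S w' → ℝ) → ℝ)
    (μ₁ : ∀ w, S w → ℝ) (hμ₁ : ∀ w, μ₁ w ∈ stdSimplex ℝ (S w))
    (hP : IsKernelMT H P)
    (hr : ∀ w h, h < H → ∀ s a (μ : ∀ w', S w' → ℝ),
      (∀ w', μ w' ∈ stdSimplex ℝ (S w')) → r w h s a μ ∈ Set.Icc (0 : ℝ) (1 / (H : ℝ)))
    (L_T L_r : ℝ) (hLT : 0 ≤ L_T) (hLr : 0 ≤ L_r)
    (hPlip : ∀ π πt : ∀ w, ℕ → S w → A w → ℝ, IsPolicyMT π → IsPolicyMT πt →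
      ∀ w h, h < H → ∀ s a,
        (∑ s', |P w h s a (densMT P μ₁ π h) s' - P w h s a (densMT P μ₁ πt h) s'|) ≤
          L_T / W * l1MT (densMT P μ₁ π h) (densMT P μ₁ πt h))
    (hrlip : ∀ π πt : ∀ w, ℕ → S w → A w → ℝ, IsPolicyMT π → IsPolicyMT πt →
      ∀ w h, h < H → ∀ s a,
        |r w h s a (densMT P μ₁ π h) - r w h s a (densMT P μ₁ πt h)| ≤
          L_r / W * l1MT (densMT P μ₁ π h) (densMT P μ₁ πt h)) :
    ∃ πNE : ∀ w, ℕ → S w → A w → ℝ, IsPolicyMT πNE ∧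
      ∀ w, ∀ πt : ∀ w', ℕ → S w' → A w' → ℝ, IsPolicyMT πt →
        JMT H P r μ₁ πt πNE w ≤ JMT H P r μ₁ πNE πNE w := by
  let E := EuclideanSpace ℝ (Σ w, Fin H × S w × A w)
  let p : E → ∀ w, ℕ → S w → A w → S w → ℝ := fun x w h s a s' =>
    P w h s a (densMT P μ₁ (policyOfVec x) h) s'
  let c : E → ∀ w, ℕ → S w → A w → ℝ := fun x w h s a =>
    r w h s a (densMT P μ₁ (policyOfVec x) h)
  let q : E → ∀ w, ℕ → S w → A w → ℝ := fun x w h =>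
    actionValue (p x w) (c x w) (policyOfVec x w) (H - (h + 1)) h
  let Φ : E → E := fun x => WithLp.toLp 2 fun i =>
    nashUpdate (policyOfVec x i.1 i.2.1 i.2.2.1) (q x i.1 i.2.1 i.2.2.1) i.2.2.2
  have hpol : ∀ x : E, IsPolicyMT (policyOfVec x) := isPolicyMT_policyOfVec
  have hPlip' : ∀ (x y : E) w h, h < H → ∀ s a s',
      |p x w h s a s' - p y w h s a s'| ≤ L_T / W *
        l1MT (densMT P μ₁ (policyOfVec x) h) (densMT P μ₁ (policyOfVec y) h) :=
    fun x y w h hh s a s' => (Finset.single_le_sum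
      (f := fun s' => |p x w h s a s' - p y w h s a s'|) (fun _ _ => abs_nonneg _)
      (Finset.mem_univ s')).trans (hPlip _ _ (hpol x) (hpol y) w h hh s a)
  have hdens : ∀ h ≤ H, ∀ w s, Continuous fun x : E => densMT P μ₁ (policyOfVec x) h w s :=
    continuous_densMT (L_T / W) continuous_policyOfVec hPlip'
  have hpc : ∀ w, ∀ h < H, ∀ s a s', Continuous fun x => p x w h s a s' :=
    fun w h hh s a s' => continuous_of_abs_sub_le_l1MT (hdens h hh.le) _
      fun x y => hPlip' x y w h hh s a s'
  have hcc : ∀ w, ∀ h < H, ∀ s a, Continuous fun x => c x w h s a :=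
    fun w h hh s a => continuous_of_abs_sub_le_l1MT (hdens h hh.le) _
      fun x y => hrlip _ _ (hpol x) (hpol y) w h hh s a
  have hqc : ∀ w, ∀ h < H, ∀ s a, Continuous fun x => q x w h s a :=
    fun w h hh s a => continuous_actionValue (hpc w) (hcc w)
      (fun h s a => continuous_policyOfVec w h s a) _ h (by lia) s a
  have hΦc : Continuous Φ := (PiLp.continuous_toLp 2 _).comp <| continuous_pi fun i =>
    continuous_nashUpdate (continuous_policyOfVec _ _ _) (hqc _ _ i.2.1.2 _) _
  have hΦ0 : ∀ x i, 0 ≤ Φ x i := fun x i => nashUpdate_nonneg (hpol x _ _ _).1 _ _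
  have hΦsum : ∀ x w (h : Fin H) s, ∑ a, Φ x ⟨w, h, s, a⟩ = 1 :=
    fun x w h s => sum_nashUpdate (hpol x w h s).2 _
  have hΦ1 : ∀ x i, Φ x i ≤ 1 := fun x i =>
    (Finset.single_le_sum (f := fun a => Φ x ⟨i.1, i.2.1, i.2.2.1, a⟩) (fun _ _ => hΦ0 x _)
      (Finset.mem_univ i.2.2.2)).trans (hΦsum x _ _ _).le
  have hΦb : ∀ x, ‖Φ x‖ ≤ √(∑ _i : (Σ w, Fin H × S w × A w), 1) := fun x => by
    rw [EuclideanSpace.norm_eq]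
    refine Real.sqrt_le_sqrt (Finset.sum_le_sum fun i _ => ?_)
    rw [Real.norm_of_nonneg (hΦ0 x i)]
    exact pow_le_one₀ (hΦ0 x i) (hΦ1 x i)
  obtain ⟨x, hx⟩ := exists_fixedPoint_of_continuous_of_bounded hΦc hΦb
  have hself : ∀ w (h : Fin H) s a, policyOfVec x w h s a = x ⟨w, h, s, a⟩ := by
    intro w h s a
    have : policyOfVec x w h s = simplexRetraction fun b => x ⟨w, h, s, b⟩ := by
      simp [policyOfVec]
    rw [this, simplexRetraction_eq_self]
    · intro b
      rw [← hx]
      exact hΦ0 x _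
    · rw [← hx]
      exact hΦsum x w h s
  have hopt : ∀ w, ∀ h < H, ∀ s a, q x w h s a ≤
      valueToGo (p x w) (c x w) (policyOfVec x w) (H - h) h s := by
    intro w h hh s a
    rw [show H - h = H - (h + 1) + 1 by lia, valueToGo_succ]
    refine le_sum_of_nashUpdate_eq (hpol x w h s).2 (fun b => ?_) a
    rw [hself w ⟨h, hh⟩ s b]
    exact congrArg (fun y : E => y ⟨w, ⟨h, hh⟩, s, b⟩) hx
  refine ⟨policyOfVec x, hpol x, fun w πt hπt => ?_⟩
  calc JMT H P r μ₁ πt (policyOfVec x) w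
      ≤ ∑ s, μ₁ w s * valueToGo (p x w) (c x w) (policyOfVec x w) H 0 s :=
        sum_reward_le_sum_valueToGo (d := densWF P μ₁ (policyOfVec x) πt w) (fun _ _ => rfl)
          (fun h hh => (densWF_mem_stdSimplex hμ₁ hP (hpol x) hπt w h hh.le).1)
          (fun h s => (hπt w h s).1) (fun h s => (hπt w h s).2) (hopt w)
    _ = JMT H P r μ₁ (policyOfVec x) (policyOfVec x) w :=
        (sum_reward_eq_sum_valueToGo (d := densWF P μ₁ (policyOfVec x) (policyOfVec x) w) H
          fun _ _ => rfl).symm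
end
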